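/- Every D-degenerate graph G on n vertices with k ≥ n edges admits a grid-drawing in [m]^3 for some m with m^3 = O(D k log n); in particular every graph of bounded maximum degree on n vertices has a grid-drawing of volume O(n log n). -/

import Mathlib

def IsGridDrawing {n : ℕ} (m : ℕ) (G : SimpleGraph (Fin n))
    (φ : Fin n → (Fin 3 → ℤ)) : Prop :=
  Function.Injective φ ∧
  (∀ v i, 0 ≤ φ v i ∧ φ v i < (m : ℤ)) ∧
  (∀ u v w, G.Adj u v → w ≠ u → w ≠ v →
    (fun i => ((φ w i : ℝ))) ∉
      openSegment ℝ (fun i => ((φ u i : ℝ))) (fun i => ((φ v i : ℝ)))) ∧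
  (∀ u v u' v', G.Adj u v → G.Adj u' v' → s(u, v) ≠ s(u', v') →
    openSegment ℝ (fun i => ((φ u i : ℝ))) (fun i => ((φ v i : ℝ))) ∩
      openSegment ℝ (fun i => ((φ u' i : ℝ))) (fun i => ((φ v' i : ℝ))) = ∅)

namespace GD

/-- cross product -/
def cr (a b : Fin 3 → ℤ) : Fin 3 → ℤ :=
  ![a 1 * b 2 - a 2 * b 1, a 2 * b 0 - a 0 * b 2, a 0 * b 1 - a 1 * b 0]

/-- dot product -/
def dt (a b : Fin 3 → ℤ) : ℤ := a 0 * b 0 + a 1 * b 1 + a 2 * b 2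

/-- sup norm -/
def nm (w : Fin 3 → ℤ) : ℤ := max |w 0| (max |w 1| |w 2|)

def Prim (e : Fin 3 → ℤ) : Prop := ∃ x : Fin 3 → ℤ, dt x e = 1

lemma cr_eq_zero_iff {a b : Fin 3 → ℤ} : cr a b = 0 ↔
    a 1 * b 2 - a 2 * b 1 = 0 ∧ a 2 * b 0 - a 0 * b 2 = 0 ∧ a 0 * b 1 - a 1 * b 0 = 0 := by
  rw [funext_iff, Fin.forall_fin_succ, Fin.forall_fin_succ, Fin.forall_fin_succ]
  simp [cr]

lemma prim_par {e c : Fin 3 → ℤ} (he : Prim e) (h : cr e c = 0) :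
    ∃ t : ℤ, ∀ i, c i = t * e i := by
  obtain ⟨x, hx⟩ := he
  obtain ⟨h0, h1, h2⟩ := cr_eq_zero_iff.1 h
  refine ⟨dt x c, ?_⟩
  simp only [dt] at *
  rw [Fin.forall_fin_succ, Fin.forall_fin_succ, Fin.forall_fin_succ]
  refine ⟨?_, ?_, ?_, fun i => i.elim0⟩
  · show c 0 = _ * e 0
    linear_combination (-c 0) * hx + x 2 * h1 - x 1 * h2
  · show c 1 = _ * e 1
    linear_combination (-c 1) * hx - x 2 * h0 + x 0 * h2
  · show c 2 = _ * e 2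
    linear_combination (-c 2) * hx + x 1 * h0 - x 0 * h1

lemma exists_prim {a : Fin 3 → ℤ} (ha : a ≠ 0) :
    ∃ (e : Fin 3 → ℤ) (g : ℤ), 0 < g ∧ (∀ i, a i = g * e i) ∧ Prim e := by
  set g12 : ℕ := Int.gcd (a 1) (a 2) with hg12
  set g : ℕ := Int.gcd (a 0) g12 with hg
  have d0 : (g : ℤ) ∣ a 0 := Int.gcd_dvd_left ..
  have d12 : (g : ℤ) ∣ g12 := Int.gcd_dvd_right ..
  have d1 : (g : ℤ) ∣ a 1 := d12.trans (Int.gcd_dvd_left ..)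
  have d2 : (g : ℤ) ∣ a 2 := d12.trans (Int.gcd_dvd_right ..)
  have hgpos : (0 : ℤ) < g := by
    rcases Nat.eq_zero_or_pos g with h | h
    · exfalso
      apply ha
      rw [h] at d0 d1 d2
      simp only [Nat.cast_zero, zero_dvd_iff] at d0 d1 d2
      funext i
      fin_cases i <;> simp [d0, d1, d2]
    · exact_mod_cast h
  have b1 := Int.gcd_eq_gcd_ab (a 1) (a 2)
  have b2 := Int.gcd_eq_gcd_ab (a 0) g12
  rw [← hg12] at b1
  rw [← hg] at b2
  have dall : ∀ i, (g : ℤ) ∣ a i := by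
    intro i; fin_cases i <;> assumption
  choose e he using dall
  refine ⟨e, g, hgpos, he, ?_⟩
  refine ⟨![Int.gcdA (a 0) g12, Int.gcdB (a 0) g12 * Int.gcdA (a 1) (a 2),
    Int.gcdB (a 0) g12 * Int.gcdB (a 1) (a 2)], ?_⟩
  have : (g : ℤ) * dt ![Int.gcdA (a 0) g12, Int.gcdB (a 0) g12 * Int.gcdA (a 1) (a 2),
    Int.gcdB (a 0) g12 * Int.gcdB (a 1) (a 2)] e = g * 1 := by
    simp only [dt, Matrix.cons_val_zero, Matrix.cons_val_one, Matrix.cons_val]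
    have e0 := he 0
    have e1 := he 1
    have e2 := he 2
    generalize Int.gcdA (a 0) g12 = A at *
    generalize Int.gcdB (a 0) g12 = B at *
    generalize Int.gcdA (a 1) (a 2) = A' at *
    generalize Int.gcdB (a 1) (a 2) = B' at *
    linear_combination (-A) * e0 - B * A' * e1 - B * B' * e2 - b2 - B * b1
  exact mul_left_cancel₀ hgpos.ne' this

noncomputable def Box (m : ℤ) : Finset (Fin 3 → ℤ) := Fintype.piFinset (fun _ => Finset.Icc (-m) m)

lemma mem_Box {m : ℤ} {a : Fin 3 → ℤ} : a ∈ Box m ↔ ∀ i, |a i| ≤ m := by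
  simp [Box, Fintype.mem_piFinset, abs_le]

lemma abs_le_nm (w : Fin 3 → ℤ) (i : Fin 3) : |w i| ≤ nm w := by
  fin_cases i <;> simp [nm]

lemma nm_eq (w : Fin 3 → ℤ) : ∃ i, |w i| = nm w := by
  unfold nm
  rcases max_choice |w 0| (max |w 1| |w 2|) with h | h
  · exact ⟨0, h.symm⟩
  · rcases max_choice |w 1| |w 2| with h' | h'
    · exact ⟨1, by rw [h, h']⟩
    · exact ⟨2, by rw [h, h']⟩

lemma nm_pos {w : Fin 3 → ℤ} (h : w ≠ 0) : 0 < nm w := by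
  by_contra hc
  apply h
  funext i
  have := abs_le_nm w i
  have h2 := abs_nonneg (w i)
  exact abs_eq_zero.1 (by omega)

lemma cr_bound {a b : Fin 3 → ℤ} {x y : ℤ} (ha : ∀ i, |a i| ≤ x) (hb : ∀ i, |b i| ≤ y) (i : Fin 3) :
    |cr a b i| ≤ 2 * x * y := by
  have key : ∀ p q r s : Fin 3, |a p * b q - a r * b s| ≤ 2 * x * y := by
    intro p q r s
    have h1 := mul_le_mul (ha p) (hb q) (abs_nonneg _) ((abs_nonneg _).trans (ha p))
    have h2 := mul_le_mul (ha r) (hb s) (abs_nonneg _) ((abs_nonneg _).trans (ha r))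
    rw [← abs_mul] at h1 h2
    calc _ ≤ |a p * b q| + |a r * b s| := abs_sub _ _
      _ ≤ _ := by linarith
  fin_cases i
  · exact key 1 2 2 1
  · exact key 2 0 0 2
  · exact key 0 1 1 0

lemma plane_count {m : ℤ} (hm : 1 ≤ m) {w s t : Fin 3 → ℤ} (hw : Prim w)
    (hs : s ∈ Box m) (ht : t ∈ Box m) (hws : dt w s = 0) (hwt : dt w t = 0) (hst : cr s t ≠ 0) :
    (((Box m).filter (fun c => dt w c = 0)).card : ℤ) * nm w ≤ 24 * m ^ 2 := by
  have hs0 : s ≠ 0 := by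
    rintro rfl
    apply hst
    rw [cr_eq_zero_iff]; simp
  have hw0 : w ≠ 0 := by
    rintro rfl
    obtain ⟨x, hx⟩ := hw
    simp [dt] at hx
  obtain ⟨e, g, hg, hse, hpe⟩ := exists_prim hs0
  have he0 : e ≠ 0 := by
    rintro rfl
    obtain ⟨x, hx⟩ := hpe
    simp [dt] at hx
  have hNpos := nm_pos hw0
  have hEpos := nm_pos he0
  obtain ⟨i0, hi0⟩ := nm_eq e
  set N := nm w with hN
  set E := nm e with hE
  have hEm : E ≤ m := by
    have h1 := mem_Box.1 hs i0
    rw [hse i0, abs_mul, hi0, abs_of_pos hg] at h1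
    nlinarith
  have hwe : dt w e = 0 := by
    have : g * dt w e = 0 := by
      rw [← hws]
      simp only [dt, hse]; ring
    rcases mul_eq_zero.1 this with h | h
    · omega
    · exact h
  have hj : ∀ c, dt w c = 0 → ∃ j : ℤ, ∀ i, cr e c i = j * w i := by
    intro c hc
    apply prim_par hw
    rw [cr_eq_zero_iff]
    simp only [dt] at hwe hc
    simp only [cr, Matrix.cons_val_zero, Matrix.cons_val_one, Matrix.cons_val]
    refine ⟨?_, ?_, ?_⟩
    · linear_combination e 0 * hc - c 0 * hwe
    · linear_combination e 1 * hc - c 1 * hwe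
    · linear_combination e 2 * hc - c 2 * hwe
  have hjb : ∀ c ∈ Box m, ∀ j : ℤ, (∀ i, cr e c i = j * w i) → |j| * N ≤ 2 * E * m := by
    intro c hc j h
    obtain ⟨i, hi⟩ := nm_eq w
    have h1 := cr_bound (abs_le_nm e) (mem_Box.1 hc) i
    rw [h i, abs_mul, hi] at h1
    exact h1
  set J : ℤ := 2 * E * m / N with hJ
  have hJ1 : 1 ≤ J := by
    obtain ⟨j, hjt⟩ := hj t hwt
    have h1 := hjb t ht j hjt
    have hj0 : j ≠ 0 := by
      rintro rfl
      apply hst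
      have h0 : cr s t = fun i => g * cr e t i := by
        funext i
        fin_cases i <;> simp [cr, hse] <;> ring
      rw [h0]
      funext i
      rw [hjt i]; simp
    have : 1 ≤ |j| := Int.one_le_abs hj0
    rw [hJ]
    apply Int.le_ediv_of_mul_le hNpos
    nlinarith
  set Q : ℤ := m / E with hQ
  have hQ1 : 1 ≤ Q := Int.le_ediv_of_mul_le hEpos (by linarith)
  have hJN : J * N ≤ 2 * E * m := Int.ediv_mul_le _ hNpos.ne'
  have hQE : Q * E ≤ m := Int.ediv_mul_le _ hEpos.ne'
  let jf : (Fin 3 → ℤ) → ℤ := fun c => if h : dt w c = 0 then (hj c h).choose else 0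
  have hjf : ∀ c, dt w c = 0 → ∀ i, cr e c i = jf c * w i := by
    intro c hc
    simp only [jf, hc, dif_pos]
    exact (hj c hc).choose_spec
  have hcard : ((Box m).filter (fun c => dt w c = 0)).card ≤
      (Finset.Icc (-J) J ×ˢ Finset.Icc (-Q - 1) Q).card := by
    apply Finset.card_le_card_of_injOn (fun c => (jf c, c i0 / E))
    · intro c hc
      rw [Finset.mem_coe, Finset.mem_filter] at hc
      have h1 := hjb c hc.1 (jf c) (hjf c hc.2)
      have h2 : |jf c| ≤ J := Int.le_ediv_of_mul_le hNpos h1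
      have h3 := abs_le.1 (mem_Box.1 hc.1 i0)
      rw [abs_le] at h2
      simp only [Finset.coe_product, Set.mem_prod, Finset.coe_Icc, Set.mem_Icc]
      refine ⟨h2, ?_, ?_⟩
      · rw [Int.le_ediv_iff_mul_le hEpos]
        have : m < (Q + 1) * E := Int.lt_ediv_add_one_mul_self m hEpos
        nlinarith
      · exact Int.ediv_le_ediv hEpos h3.2
    · intro c hc d hd hcd
      rw [Finset.mem_coe, Finset.mem_filter] at hc hd
      simp only [Prod.mk.injEq] at hcd
      obtain ⟨h1, h2⟩ := hcd
      have h3 : cr e (c - d) = 0 := by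
        have : cr e (c - d) = fun i => cr e c i - cr e d i := by
          funext i
          fin_cases i <;> simp [cr] <;> ring
        rw [this]
        funext i
        rw [hjf c hc.2, hjf d hd.2, h1]; simp
      obtain ⟨k, hk⟩ := prim_par hpe h3
      have h4 : |c i0 - d i0| < E := by
        have a1 := Int.ediv_mul_le (c i0) hEpos.ne'
        have a2 := Int.lt_ediv_add_one_mul_self (c i0) hEpos
        have b1 := Int.ediv_mul_le (d i0) hEpos.ne'
        have b2 := Int.lt_ediv_add_one_mul_self (d i0) hEpos
        rw [h2] at a1 a2
        rw [abs_lt]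
        constructor <;> linarith
      have h5 := hk i0
      simp only [Pi.sub_apply] at h5
      rw [h5, abs_mul, hi0] at h4
      have hk0 : k = 0 := by
        by_contra hne
        have := Int.one_le_abs hne
        nlinarith
      funext i
      have := hk i
      rw [hk0] at this
      simp at this
      linarith
  rw [Finset.card_product, Int.card_Icc, Int.card_Icc] at hcard
  have hcard' : (((Box m).filter (fun c => dt w c = 0)).card : ℤ) ≤ (2 * J + 1) * (2 * Q + 2) := by
    have : (((Box m).filter (fun c => dt w c = 0)).card : ℤ) ≤
      ((J + 1 - -J).toNat * (Q + 1 - (-Q - 1)).toNat : ℕ) := by exact_mod_cast hcard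
    rw [Nat.cast_mul, Int.toNat_of_nonneg (by omega), Int.toNat_of_nonneg (by omega)] at this
    linarith
  have h6 : (2 * J + 1) * (2 * Q + 2) ≤ 12 * (J * Q) := by nlinarith
  calc _ ≤ 12 * (J * Q) * N := by
        apply mul_le_mul_of_nonneg_right (hcard'.trans h6) hNpos.le
    _ = 12 * Q * (J * N) := by ring
    _ ≤ 12 * Q * (2 * E * m) := by
        apply mul_le_mul_of_nonneg_left hJN; linarith
    _ = 24 * m * (Q * E) := by ring
    _ ≤ 24 * m * m := by
        apply mul_le_mul_of_nonneg_left hQE; linarith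
    _ = _ := by ring

lemma span_exists {m : ℤ} (hm : 1 ≤ m) {a b c : Fin 3 → ℤ} (ha : a ∈ Box m) (hb : b ∈ Box m)
    (hc : c ∈ Box m) (h : dt (cr a b) c = 0) :
    ∃ s ∈ Box m, ∃ t ∈ Box m, cr s t ≠ 0 ∧ dt (cr s t) a = 0 ∧ dt (cr s t) b = 0 ∧
      dt (cr s t) c = 0 := by
  have e0 : (![1, 0, 0] : Fin 3 → ℤ) ∈ Box m := by
    rw [mem_Box]; intro i; fin_cases i <;> simp <;> omega
  have e1 : (![0, 1, 0] : Fin 3 → ℤ) ∈ Box m := by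
    rw [mem_Box]; intro i; fin_cases i <;> simp <;> omega
  have unit : ∀ p : Fin 3 → ℤ, p ≠ 0 → ∃ t ∈ Box m, cr p t ≠ 0 := by
    intro p hp
    by_contra hcon
    push Not at hcon
    apply hp
    have h0 := cr_eq_zero_iff.1 (hcon _ e0)
    have h1 := cr_eq_zero_iff.1 (hcon _ e1)
    simp at h0 h1
    funext i
    fin_cases i <;> simp <;> tauto
  have self1 : ∀ p q, dt (cr p q) p = 0 := by intro p q; simp [cr, dt]; ring
  have self2 : ∀ p q, dt (cr p q) q = 0 := by intro p q; simp [cr, dt]; ring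
  have cyc : ∀ p q r, dt (cr p q) r = - dt (cr p r) q := by intro p q r; simp [cr, dt]; ring
  have cyc2 : ∀ p q r, dt (cr p q) r = dt (cr q r) p := by intro p q r; simp [cr, dt]; ring
  have par : ∀ p t q, cr p q = 0 → dt (cr p t) q = 0 := by
    intro p t q h
    rw [cyc, h]; simp [dt]
  have anti : ∀ p q, cr p q = 0 → cr q p = 0 := by
    intro p q h
    rw [cr_eq_zero_iff] at h ⊢
    obtain ⟨h1, h2, h3⟩ := h
    refine ⟨?_, ?_, ?_⟩ <;> linarith
  by_cases hab : cr a b = 0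
  · by_cases hac : cr a c = 0
    · by_cases hbc : cr b c = 0
      · by_cases ha0 : a = 0
        · by_cases hb0 : b = 0
          · by_cases hc0 : c = 0
            · refine ⟨_, e0, _, e1, ?_, ?_, ?_, ?_⟩
              · rw [Ne, cr_eq_zero_iff]; simp
              · simp [ha0, dt]
              · simp [hb0, dt]
              · simp [hc0, dt]
            · obtain ⟨t, ht, h'⟩ := unit c hc0
              exact ⟨c, hc, t, ht, h', par _ _ _ (anti _ _ hac), par _ _ _ (anti _ _ hbc), self1 _ _⟩
          · obtain ⟨t, ht, h'⟩ := unit b hb0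
            exact ⟨b, hb, t, ht, h', par _ _ _ (anti _ _ hab), self1 _ _, par _ _ _ hbc⟩
        · obtain ⟨t, ht, h'⟩ := unit a ha0
          exact ⟨a, ha, t, ht, h', self1 _ _, par _ _ _ hab, par _ _ _ hac⟩
      · exact ⟨b, hb, c, hc, hbc, by rw [← cyc2, h], self1 _ _, self2 _ _⟩
    · exact ⟨a, ha, c, hc, hac, self1 _ _, by rw [cyc, h, neg_zero], self2 _ _⟩
  · exact ⟨a, ha, b, hb, hab, self1 _ _, self2 _ _, h⟩

lemma sphere_count (X : ℤ) (N : ℕ) (hN : 1 ≤ N) :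
    (((Box X).filter (fun w => nm w = N)).card) ≤ 54 * N ^ 2 := by
  have hsub : (Box X).filter (fun w => nm w = N) ⊆
      (Finset.univ : Finset (Fin 3)).biUnion (fun i => Fintype.piFinset
        (fun j => if j = i then ({(N : ℤ), -(N : ℤ)} : Finset ℤ) else Finset.Icc (-(N : ℤ)) N)) := by
    intro w hw
    rw [Finset.mem_filter] at hw
    obtain ⟨i, hi⟩ := nm_eq w
    simp only [Finset.mem_biUnion, Finset.mem_univ, true_and, Fintype.mem_piFinset]
    refine ⟨i, fun j => ?_⟩
    split_ifs with hji
    · subst hji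
      rw [hw.2] at hi
      have := (abs_eq (by positivity)).1 hi
      simpa using this
    · have := abs_le_nm w j
      rw [hw.2, abs_le] at this
      simpa using this
  have h2 : (({(N : ℤ), -(N : ℤ)} : Finset ℤ)).card ≤ 2 := Finset.card_le_two
  have h3 : ((Finset.Icc (-(N : ℤ)) N).card) = 2 * N + 1 := by
    rw [Int.card_Icc]; omega
  calc _ ≤ _ := Finset.card_le_card hsub
    _ ≤ ∑ i : Fin 3, (Fintype.piFinset
        (fun j => if j = i then ({(N : ℤ), -(N : ℤ)} : Finset ℤ) else Finset.Icc (-(N : ℤ)) N)).card :=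
        Finset.card_biUnion_le
    _ ≤ ∑ i : Fin 3, 18 * N ^ 2 := by
        apply Finset.sum_le_sum
        intro i _
        rw [Fintype.card_piFinset, Fin.prod_univ_three]
        have h4 : 2 * (2 * N + 1) * (2 * N + 1) ≤ 18 * N ^ 2 := by nlinarith
        refine le_trans ?_ h4
        fin_cases i <;> simp [h3] <;> nlinarith
    _ = _ := by simp; ring

lemma sphere_sum (X : ℕ) :
    ∑ w ∈ (Box X).filter (fun w => w ≠ 0), (1 : ℝ) / (nm w : ℝ) ^ 3 ≤ 54 * (1 + Real.log X) := by
  have hmaps : ∀ w ∈ (Box X).filter (fun w => w ≠ 0), (nm w).toNat ∈ Finset.Icc 1 X := by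
    intro w hw
    rw [Finset.mem_filter, mem_Box] at hw
    have := nm_pos hw.2
    obtain ⟨i, hi⟩ := nm_eq w
    have h2 := hw.1 i
    rw [hi] at h2
    rw [Finset.mem_Icc]; omega
  rw [← Finset.sum_fiberwise_of_maps_to hmaps]
  calc _ ≤ ∑ N ∈ Finset.Icc 1 X, 54 * ((N : ℝ)⁻¹) := by
        apply Finset.sum_le_sum
        intro N hN
        rw [Finset.mem_Icc] at hN
        have hNr : (1 : ℝ) ≤ N := by exact_mod_cast hN.1
        calc _ = ∑ w ∈ ((Box X).filter (fun w => w ≠ 0)).filter (fun w => (nm w).toNat = N),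
              (1 : ℝ) / (N : ℝ) ^ 3 := by
              apply Finset.sum_congr rfl
              intro w hw
              rw [Finset.mem_filter] at hw
              have : nm w = N := by have := hw.2; omega
              rw [this]; simp
          _ = (((Box X).filter (fun w => w ≠ 0)).filter (fun w => (nm w).toNat = N)).card *
              ((1 : ℝ) / (N : ℝ) ^ 3) := by rw [Finset.sum_const, nsmul_eq_mul]
          _ ≤ (54 * N ^ 2 : ℕ) * ((1 : ℝ) / (N : ℝ) ^ 3) := by
              apply mul_le_mul_of_nonneg_right _ (by positivity)
              norm_cast
              refine le_trans (Finset.card_le_card ?_) (sphere_count X N hN.1)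
              intro w hw
              simp only [Finset.mem_filter] at hw ⊢
              refine ⟨hw.1.1, by have := hw.2; omega⟩
          _ = 54 * ((N : ℝ)⁻¹) := by
              push_cast
              field_simp
    _ = 54 * ((harmonic X : ℚ) : ℝ) := by
        rw [← Finset.mul_sum, harmonic_eq_sum_Icc]; push_cast; rfl
    _ ≤ _ := by
        have := harmonic_le_one_add_log X
        linarith

lemma singular_count (m : ℕ) (hm : 1 ≤ m) :
    ((((Box m ×ˢ Box m ×ˢ Box m)).filter
      (fun t => dt (cr t.1 t.2.1) t.2.2 = 0)).card : ℝ) ≤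
      746496 * (m : ℝ) ^ 6 * (1 + Real.log ((2 * m ^ 2 : ℕ) : ℝ)) := by
  classical
  have hm' : (1 : ℤ) ≤ m := by exact_mod_cast hm
  set X : ℕ := 2 * m ^ 2 with hX
  let F : (Fin 3 → ℤ) → Finset (Fin 3 → ℤ) := fun w => (Box m).filter (fun c => dt w c = 0)
  let W := ((Box X).filter (fun w => w ≠ 0)).filter (fun w => Prim w ∧
    ∃ s ∈ Box m, ∃ t ∈ Box m, cr s t ≠ 0 ∧ dt w s = 0 ∧ dt w t = 0)
  have hsub : ((Box m ×ˢ Box m ×ˢ Box m)).filter (fun t => dt (cr t.1 t.2.1) t.2.2 = 0) ⊆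
      W.biUnion (fun w => F w ×ˢ F w ×ˢ F w) := by
    rintro ⟨a, b, c⟩ h
    simp only [Finset.mem_filter, Finset.mem_product] at h
    obtain ⟨⟨ha, hb, hc⟩, h0⟩ := h
    obtain ⟨s, hs, t, ht, hst, h1, h2, h3⟩ := span_exists hm' ha hb hc h0
    obtain ⟨w, g, hg, hwg, hpw⟩ := exists_prim hst
    have key : ∀ c, dt (cr s t) c = 0 → dt w c = 0 := by
      intro c hc
      have : g * dt w c = 0 := by
        rw [← hc]
        simp only [dt, hwg]; ring
      rcases mul_eq_zero.1 this with h | h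
      · omega
      · exact h
    have hw0 : w ≠ 0 := by
      rintro rfl
      obtain ⟨x, hx⟩ := hpw
      simp [dt] at hx
    have hwX : w ∈ Box X := by
      rw [mem_Box]
      intro i
      have := cr_bound (mem_Box.1 hs) (mem_Box.1 ht) i
      rw [hwg i, abs_mul, abs_of_pos hg] at this
      have h0 := abs_nonneg (w i)
      rw [hX]; push_cast
      nlinarith
    simp only [Finset.mem_biUnion, Finset.mem_product]
    refine ⟨w, ?_, ?_, ?_, ?_⟩
    · simp only [W, Finset.mem_filter]
      refine ⟨⟨hwX, hw0⟩, hpw, s, hs, t, ht, hst, key _ ?_, key _ ?_⟩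
      · simp [cr, dt]; ring
      · simp [cr, dt]; ring
    · simp only [F, Finset.mem_filter]; exact ⟨ha, key _ h1⟩
    · simp only [F, Finset.mem_filter]; exact ⟨hb, key _ h2⟩
    · simp only [F, Finset.mem_filter]; exact ⟨hc, key _ h3⟩
  have hF : ∀ w ∈ W, ((F w).card : ℝ) ≤ 24 * (m : ℝ) ^ 2 / (nm w : ℝ) := by
    intro w hw
    simp only [W, Finset.mem_filter] at hw
    obtain ⟨⟨_, hw0⟩, hp, s, hs, t, ht, hst, h1, h2⟩ := hw
    have := plane_count hm' hp hs ht h1 h2 hst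
    have hpos : (0 : ℝ) < nm w := by exact_mod_cast nm_pos hw0
    rw [le_div_iff₀ hpos]
    exact_mod_cast this
  calc _ ≤ ((W.biUnion (fun w => F w ×ˢ F w ×ˢ F w)).card : ℝ) := by
        exact_mod_cast Finset.card_le_card hsub
    _ ≤ ((∑ w ∈ W, (F w ×ˢ F w ×ˢ F w).card : ℕ) : ℝ) := by
        exact_mod_cast Finset.card_biUnion_le
    _ = ∑ w ∈ W, ((F w).card : ℝ) ^ 3 := by
        push_cast
        apply Finset.sum_congr rfl
        intro w _
        rw [Finset.card_product, Finset.card_product]; push_cast; ring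
    _ ≤ ∑ w ∈ W, (13824 * (m : ℝ) ^ 6) * (1 / (nm w : ℝ) ^ 3) := by
        apply Finset.sum_le_sum
        intro w hw
        calc _ ≤ (24 * (m : ℝ) ^ 2 / (nm w : ℝ)) ^ 3 :=
              pow_le_pow_left₀ (by positivity) (hF w hw) 3
          _ = _ := by ring
    _ ≤ ∑ w ∈ (Box X).filter (fun w => w ≠ 0), (13824 * (m : ℝ) ^ 6) * (1 / (nm w : ℝ) ^ 3) := by
        apply Finset.sum_le_sum_of_subset_of_nonneg (Finset.filter_subset _ _)
        intro w hw _
        have hpos : (0 : ℝ) < nm w := by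
          exact_mod_cast nm_pos (Finset.mem_filter.1 hw).2
        positivity
    _ ≤ (13824 * (m : ℝ) ^ 6) * (54 * (1 + Real.log X)) := by
        rw [← Finset.mul_sum]
        apply mul_le_mul_of_nonneg_left (sphere_sum X) (by positivity)
    _ = _ := by ring

section Move
variable {V P : Type} [Fintype V] [DecidableEq V] [Fintype P]

lemma mv2 (k : P → P → ℝ) (ks : ∀ p q, k p q = k q p) (H : V → V → ℝ) (h1 : ∀ x, H x x = 0)
    (φ : V → P) (z : V) :
    ∑ p : P, ∑ x, ∑ y, H x y * k (Function.update φ z p x) (Function.update φ z p y) =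
      (Fintype.card P : ℝ) * (∑ x, ∑ y, H x y * k (φ x) (φ y)) +
      ∑ y, (H z y + H y z) * ((∑ p, k p (φ y)) - (Fintype.card P : ℝ) * k (φ z) (φ y)) := by
  have term : ∀ x y, ∑ p : P, H x y * k (Function.update φ z p x) (Function.update φ z p y) =
      (Fintype.card P : ℝ) * (H x y * k (φ x) (φ y)) +
      ((if x = z then H z y * ((∑ p, k p (φ y)) - (Fintype.card P : ℝ) * k (φ z) (φ y)) else 0) +
      (if y = z then H x z * ((∑ p, k p (φ x)) - (Fintype.card P : ℝ) * k (φ z) (φ x)) else 0)) := by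
    intro x y
    rw [← Finset.mul_sum]
    by_cases hx : x = z
    · subst hx
      by_cases hy : y = x
      · subst hy; simp [h1]
      · simp [hy]; ring
    · by_cases hy : y = z
      · subst hy
        simp only [Function.update_self, Function.update_of_ne hx, if_neg hx, if_true]
        rw [ks (φ x) (φ y)]
        simp only [ks (φ x)]
        ring
      · simp [hx, hy]; ring
  rw [Finset.sum_comm]
  simp_rw [Finset.sum_comm (s := (Finset.univ : Finset P)), term, Finset.sum_add_distrib,
    ← Finset.mul_sum]
  congr 1
  simp only [Finset.sum_ite_eq', Finset.mem_univ, if_true, Finset.sum_ite_irrel, Finset.sum_const_zero,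
    add_mul, Finset.sum_add_distrib]

lemma mv3 (k : P → P → P → ℝ) (ks : ∀ p q r, k p q r = k q p r) (kt : ∀ p q r, k p q r = k p r q)
    (H : V → V → V → ℝ) (h12 : ∀ x y, H x x y = 0) (h13 : ∀ x y, H x y x = 0)
    (h23 : ∀ x y, H y x x = 0)
    (φ : V → P) (z : V) :
    ∑ p : P, ∑ x, ∑ y, ∑ u, H x y u *
      k (Function.update φ z p x) (Function.update φ z p y) (Function.update φ z p u) =
      (Fintype.card P : ℝ) * (∑ x, ∑ y, ∑ u, H x y u * k (φ x) (φ y) (φ u)) +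
      ∑ x, ∑ y, (H z x y + H x z y + H x y z) *
        ((∑ p, k p (φ x) (φ y)) - (Fintype.card P : ℝ) * k (φ z) (φ x) (φ y)) := by
  have term : ∀ x y u, ∑ p : P, H x y u *
      k (Function.update φ z p x) (Function.update φ z p y) (Function.update φ z p u) =
      (Fintype.card P : ℝ) * (H x y u * k (φ x) (φ y) (φ u)) +
      ((if x = z then H z y u *
        ((∑ p, k p (φ y) (φ u)) - (Fintype.card P : ℝ) * k (φ z) (φ y) (φ u)) else 0) +
      (if y = z then H x z u *
        ((∑ p, k p (φ x) (φ u)) - (Fintype.card P : ℝ) * k (φ z) (φ x) (φ u)) else 0) +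
      (if u = z then H x y z *
        ((∑ p, k p (φ x) (φ y)) - (Fintype.card P : ℝ) * k (φ z) (φ x) (φ y)) else 0)) := by
    intro x y u
    rw [← Finset.mul_sum]
    by_cases hx : x = z
    · subst hx
      by_cases hy : y = x
      · subst hy; simp [h12, h13]
      · by_cases hu : u = x
        · subst hu; simp [h13, hy]
        · simp [hy, hu]; ring
    · by_cases hy : y = z
      · subst hy
        by_cases hu : u = y
        · subst hu; simp [h23, hx]
        · simp only [Function.update_self, Function.update_of_ne hx, Function.update_of_ne hu,
            if_neg hx, if_neg hu, if_true]
          simp only [ks (φ x)]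
          ring
      · by_cases hu : u = z
        · subst hu
          simp only [Function.update_self, Function.update_of_ne hx, Function.update_of_ne hy,
            if_neg hx, if_neg hy, if_true]
          have : ∀ p, k (φ x) (φ y) p = k p (φ x) (φ y) := by
            intro p; rw [kt, ks]
          simp only [this]
          ring
        · simp [hx, hy, hu]; ring
  simp_rw [Finset.sum_comm (s := (Finset.univ : Finset P)), term, Finset.sum_add_distrib,
    ← Finset.mul_sum]
  congr 1
  simp only [Finset.sum_ite_eq', Finset.mem_univ, if_true, Finset.sum_ite_irrel, Finset.sum_const_zero,
    add_mul, Finset.sum_add_distrib]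

lemma mv4 (k : P → P → P → P → ℝ) (ks : ∀ p q r s, k p q r s = k q p r s)
    (kt : ∀ p q r s, k p q r s = k p r q s) (ku : ∀ p q r s, k p q r s = k p q s r)
    (H : V → V → V → V → ℝ) (h12 : ∀ x y u, H x x y u = 0) (h13 : ∀ x y u, H x y x u = 0)
    (h14 : ∀ x y u, H x y u x = 0) (h23 : ∀ x y u, H y x x u = 0) (h24 : ∀ x y u, H y x u x = 0)
    (h34 : ∀ x y u, H y u x x = 0)
    (φ : V → P) (z : V) :
    ∑ p : P, ∑ x, ∑ y, ∑ u, ∑ v, H x y u v *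
      k (Function.update φ z p x) (Function.update φ z p y) (Function.update φ z p u)
        (Function.update φ z p v) =
      (Fintype.card P : ℝ) * (∑ x, ∑ y, ∑ u, ∑ v, H x y u v * k (φ x) (φ y) (φ u) (φ v)) +
      ∑ x, ∑ y, ∑ u, (H z x y u + H x z y u + H x y z u + H x y u z) *
        ((∑ p, k p (φ x) (φ y) (φ u)) - (Fintype.card P : ℝ) * k (φ z) (φ x) (φ y) (φ u)) := by
  have term : ∀ x y u v, ∑ p : P, H x y u v *
      k (Function.update φ z p x) (Function.update φ z p y) (Function.update φ z p u)
        (Function.update φ z p v) =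
      (Fintype.card P : ℝ) * (H x y u v * k (φ x) (φ y) (φ u) (φ v)) +
      ((if x = z then H z y u v *
        ((∑ p, k p (φ y) (φ u) (φ v)) - (Fintype.card P : ℝ) * k (φ z) (φ y) (φ u) (φ v)) else 0) +
      (if y = z then H x z u v *
        ((∑ p, k p (φ x) (φ u) (φ v)) - (Fintype.card P : ℝ) * k (φ z) (φ x) (φ u) (φ v)) else 0) +
      (if u = z then H x y z v *
        ((∑ p, k p (φ x) (φ y) (φ v)) - (Fintype.card P : ℝ) * k (φ z) (φ x) (φ y) (φ v)) else 0) +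
      (if v = z then H x y u z *
        ((∑ p, k p (φ x) (φ y) (φ u)) - (Fintype.card P : ℝ) * k (φ z) (φ x) (φ y) (φ u)) else 0))
          := by
    intro x y u v
    rw [← Finset.mul_sum]
    by_cases hx : x = z
    · subst hx
      by_cases hy : y = x
      · subst hy; simp [h12, h13, h14]
      · by_cases hu : u = x
        · subst hu; simp [h13, h14, hy]
        · by_cases hv : v = x
          · subst hv; simp [h14, hy, hu]
          · simp [hy, hu, hv]; ring
    · by_cases hy : y = z
      · subst hy
        by_cases hu : u = y
        · subst hu; simp [h23, h24, hx]
        · by_cases hv : v = y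
          · subst hv; simp [h24, hx, hu]
          · simp only [Function.update_self, Function.update_of_ne hx, Function.update_of_ne hu,
              Function.update_of_ne hv, if_neg hx, if_neg hu, if_neg hv, if_true]
            simp only [ks (φ x)]
            ring
      · by_cases hu : u = z
        · subst hu
          by_cases hv : v = u
          · subst hv; simp [h34, hx, hy]
          · simp only [Function.update_self, Function.update_of_ne hx, Function.update_of_ne hy,
              Function.update_of_ne hv, if_neg hx, if_neg hy, if_neg hv, if_true]
            have : ∀ p, k (φ x) (φ y) p (φ v) = k p (φ x) (φ y) (φ v) := by
              intro p; rw [kt, ks]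
            simp only [this]
            ring
        · by_cases hv : v = z
          · subst hv
            simp only [Function.update_self, Function.update_of_ne hx, Function.update_of_ne hy,
              Function.update_of_ne hu, if_neg hx, if_neg hy, if_neg hu, if_true]
            have : ∀ p, k (φ x) (φ y) (φ u) p = k p (φ x) (φ y) (φ u) := by
              intro p; rw [ku, kt, ks]
            simp only [this]
            ring
          · simp [hx, hy, hu, hv]; ring
  simp_rw [Finset.sum_comm (s := (Finset.univ : Finset P)), term, Finset.sum_add_distrib,
    ← Finset.mul_sum]
  congr 1
  simp only [Finset.sum_ite_eq', Finset.mem_univ, if_true, Finset.sum_ite_irrel, Finset.sum_const_zero,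
    add_mul, Finset.sum_add_distrib]

end Move
section Minimize
variable {V P : Type} [Fintype V] [DecidableEq V] [Fintype P]

/-- indicator of distinctness -/
def df (x y : V) : ℝ := if x = y then 0 else 1

lemma df_nonneg (x y : V) : 0 ≤ df x y := by unfold df; split_ifs <;> norm_num
lemma df_le (x y : V) : df x y ≤ 1 := by unfold df; split_ifs <;> norm_num
lemma df_self (x : V) : df x x = 0 := by simp [df]
lemma df_comm (x y : V) : df x y = df y x := by simp [df, eq_comm]

def H4 (w : V → V → ℝ) (x y u v : V) : ℝ :=
  w x y * w u v * (df x u * df x v * df y u * df y v)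
def H3 (w : V → V → ℝ) (l : V → ℝ) (u x y : V) : ℝ := l u * w x y * (df u x * df u y)
def H2 (w : V → V → ℝ) (l : V → ℝ) (K : ℝ) (u x : V) : ℝ := df u x * l u * l x + K * w u x

def E4 (w : V → V → ℝ) (k4 : P → P → P → P → ℝ) (φ : V → P) (z : V) : ℝ :=
  ∑ x, ∑ y, ∑ u, H4 w z x y u * k4 (φ z) (φ x) (φ y) (φ u)
def AA (w : V → V → ℝ) (k3 : P → P → P → ℝ) (φ : V → P) (x : V) : ℝ :=
  ∑ y, ∑ u, w y u * (df x y * df x u) * k3 (φ x) (φ y) (φ u)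
def BB (l : V → ℝ) (k2 : P → P → ℝ) (φ : V → P) (y : V) : ℝ :=
  ∑ u, df y u * l u * k2 (φ y) (φ u)
def gg (w : V → V → ℝ) (k2 : P → P → ℝ) (φ : V → P) (z : V) : ℝ :=
  ∑ y, w z y * k2 (φ z) (φ y)

lemma D4_le (w : V → V → ℝ) (w0 : ∀ x y, 0 ≤ w x y) (ws : ∀ x y, w x y = w y x)
    (k4 : P → P → P → P → ℝ) (k3 : P → P → P → ℝ)
    (ks : ∀ p q r s, k4 p q r s = k4 q p r s)
    (kt : ∀ p q r s, k4 p q r s = k4 p r q s) (ku : ∀ p q r s, k4 p q r s = k4 p q s r)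
    (k4n : ∀ p q r s, 0 ≤ k4 p q r s)
    (k3n : ∀ p q r, 0 ≤ k3 p q r)
    (k3s : ∀ p q r, k3 p q r = k3 q p r) (k3t : ∀ p q r, k3 p q r = k3 p r q)
    (hk : ∀ q r s, ∑ p, k4 p q r s = (Fintype.card P : ℝ) * k3 q r s)
    (φ : V → P) (z : V) (α lz : ℝ) (hα : ∀ x, AA w k3 φ x ≤ α) (hα0 : 0 ≤ α)
    (hl : ∑ y, w z y ≤ lz) :
    ∑ x, ∑ y, ∑ u, (H4 w z x y u + H4 w x z y u + H4 w x y z u + H4 w x y u z) *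
        ((∑ p, k4 p (φ x) (φ y) (φ u)) - (Fintype.card P : ℝ) * k4 (φ z) (φ x) (φ y) (φ u))
      ≤ (Fintype.card P : ℝ) * (4 * lz * α - E4 w k4 φ z) := by
  set M : ℝ := (Fintype.card P : ℝ) with hM
  have hM0 : 0 ≤ M := by positivity
  simp only [hk]
  set F : V → V → V → ℝ := fun x y u => M * k3 (φ x) (φ y) (φ u) - M * k4 (φ z) (φ x) (φ y) (φ u) with hF
  have Frot : ∀ x y u, F x y u = F u x y := by
    intro x y u
    simp only [hF]
    rw [k3t, k3s, kt _ (φ u), ku (φ z) (φ x) (φ u)]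
  have e1 : ∀ x y u, H4 w x z y u = H4 w z x y u := by
    intro x y u; unfold H4; rw [ws x z]; ring
  have e2 : ∀ x y u, H4 w x y z u = H4 w z u x y := by
    intro x y u; unfold H4; rw [df_comm x z, df_comm y z, df_comm x u, df_comm y u]; ring
  have e3 : ∀ x y u, H4 w x y u z = H4 w z u x y := by
    intro x y u; unfold H4
    rw [df_comm x z, df_comm y z, df_comm x u, df_comm y u, ws u z]; ring
  have key : ∑ x, ∑ y, ∑ u, (H4 w z x y u + H4 w x z y u + H4 w x y z u + H4 w x y u z) * F x y u
      = 4 * ∑ x, ∑ y, ∑ u, H4 w z x y u * F x y u := by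
    have r : ∑ x, ∑ y, ∑ u, H4 w z u x y * F x y u = ∑ x, ∑ y, ∑ u, H4 w z x y u * F x y u := by
      calc _ = ∑ x, ∑ u, ∑ y, H4 w z u x y * F x y u :=
            Finset.sum_congr rfl fun x _ => Finset.sum_comm
        _ = ∑ u, ∑ x, ∑ y, H4 w z u x y * F x y u := Finset.sum_comm
        _ = _ := by simp only [Frot _ _ _]
    simp only [e1, e2, e3, add_mul, Finset.sum_add_distrib, r]
    ring
  rw [key]
  have split : ∑ x, ∑ y, ∑ u, H4 w z x y u * F x y u =
      M * (∑ x, ∑ y, ∑ u, H4 w z x y u * k3 (φ x) (φ y) (φ u)) - M * E4 w k4 φ z := by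
    simp only [E4, Finset.mul_sum, ← Finset.sum_sub_distrib]
    refine Finset.sum_congr rfl fun x _ => Finset.sum_congr rfl fun y _ =>
      Finset.sum_congr rfl fun u _ => ?_
    simp only [hF]; ring
  have b1 : ∑ x, ∑ y, ∑ u, H4 w z x y u * k3 (φ x) (φ y) (φ u) ≤ lz * α := by
    calc _ ≤ ∑ x, w z x * AA w k3 φ x := by
          refine Finset.sum_le_sum fun x _ => ?_
          simp only [AA, Finset.mul_sum]
          refine Finset.sum_le_sum fun y _ => Finset.sum_le_sum fun u _ => ?_
          unfold H4
          have h1 : df z y * df z u ≤ 1 := mul_le_one₀ (df_le _ _) (df_nonneg _ _) (df_le _ _)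
          have h2 : 0 ≤ w z x * w y u * (df x y * df x u) * k3 (φ x) (φ y) (φ u) := by
            have := df_nonneg x y
            have := df_nonneg x u
            have := w0 z x
            have := w0 y u
            have := k3n (φ x) (φ y) (φ u)
            positivity
          nlinarith [mul_le_mul_of_nonneg_right h1 h2]
      _ ≤ ∑ x, w z x * α := Finset.sum_le_sum fun x _ => mul_le_mul_of_nonneg_left (hα x) (w0 _ _)
      _ = (∑ x, w z x) * α := by rw [Finset.sum_mul]
      _ ≤ _ := mul_le_mul_of_nonneg_right hl hα0
  have E0 : 0 ≤ E4 w k4 φ z := by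
    unfold E4
    refine Finset.sum_nonneg fun x _ => Finset.sum_nonneg fun y _ => Finset.sum_nonneg fun u _ => ?_
    unfold H4
    have := df_nonneg z y
    have := df_nonneg z u
    have := df_nonneg x y
    have := df_nonneg x u
    have := w0 z x
    have := w0 y u
    have := k4n (φ z) (φ x) (φ y) (φ u)
    positivity
  rw [split]
  nlinarith [mul_le_mul_of_nonneg_left b1 hM0, mul_nonneg hM0 E0]

lemma D3_le (w : V → V → ℝ) (w0 : ∀ x y, 0 ≤ w x y) (ws : ∀ x y, w x y = w y x)
    (l : V → ℝ) (l0 : ∀ x, 0 ≤ l x) 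
    (k3 : P → P → P → ℝ) (k2 : P → P → ℝ)
    (k3n : ∀ p q r, 0 ≤ k3 p q r)
    (k2n : ∀ p q, 0 ≤ k2 p q)
    (k2s : ∀ p q, k2 p q = k2 q p)
    (hk : ∀ q r, ∑ p, k3 p q r = (Fintype.card P : ℝ) * k2 q r)
    (φ : V → P) (z : V) (β : ℝ) (hβ : ∀ x, BB l k2 φ x ≤ β) (hβ0 : 0 ≤ β)
    (hl : ∑ y, w z y ≤ l z) :
    ∑ x, ∑ y, (H3 w l z x y + H3 w l x z y + H3 w l x y z) *
        ((∑ p, k3 p (φ x) (φ y)) - (Fintype.card P : ℝ) * k3 (φ z) (φ x) (φ y))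
      ≤ (Fintype.card P : ℝ) * (l z * (∑ x, gg w k2 φ x) + 2 * l z * β - l z * AA w k3 φ z) := by
  set M : ℝ := (Fintype.card P : ℝ) with hM
  have hM0 : 0 ≤ M := by positivity
  simp only [hk]
  have e3 : ∀ x y, H3 w l x y z = H3 w l x z y := by
    intro x y; unfold H3; rw [ws y z]; ring
  have H3n : ∀ x y u, 0 ≤ H3 w l x y u := by
    intro x y u
    unfold H3
    have := df_nonneg x y
    have := df_nonneg x u
    have := w0 y u
    have := l0 x
    positivity
  have step : ∀ x y, (H3 w l z x y + H3 w l x z y + H3 w l x y z) *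
        (M * k2 (φ x) (φ y) - M * k3 (φ z) (φ x) (φ y)) ≤
      M * (l z * (w x y * k2 (φ x) (φ y))) - M * (l z * (w x y * (df z x * df z y) * k3 (φ z) (φ x) (φ y)))
       + 2 * M * (w z y * (df y x * l x * k2 (φ y) (φ x))) := by
    intro x y
    rw [e3, k2s (φ y) (φ x), df_comm y x]
    have a1 : H3 w l x z y * (M * k3 (φ z) (φ x) (φ y)) ≥ 0 :=
      mul_nonneg (H3n _ _ _) (mul_nonneg hM0 (k3n _ _ _))
    have h1 : df z x * df z y ≤ 1 := mul_le_one₀ (df_le _ _) (df_nonneg _ _) (df_le _ _)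
    have a2 : H3 w l z x y * (M * k2 (φ x) (φ y)) ≤ M * (l z * (w x y * k2 (φ x) (φ y))) := by
      unfold H3
      have h2 : 0 ≤ l z * w x y * (M * k2 (φ x) (φ y)) :=
        mul_nonneg (mul_nonneg (l0 _) (w0 _ _)) (mul_nonneg hM0 (k2n _ _))
      nlinarith [mul_le_mul_of_nonneg_right h1 h2]
    have a3 : H3 w l x z y * (M * k2 (φ x) (φ y)) ≤ M * (w z y * (df x y * l x * k2 (φ x) (φ y))) := by
      unfold H3
      have h2 : 0 ≤ l x * w z y * (M * k2 (φ x) (φ y)) * df x y :=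
        mul_nonneg (mul_nonneg (mul_nonneg (l0 _) (w0 _ _)) (mul_nonneg hM0 (k2n _ _))) (df_nonneg _ _)
      nlinarith [mul_le_mul_of_nonneg_right (df_le x z) h2]
    have a4 : H3 w l z x y * (M * k3 (φ z) (φ x) (φ y)) =
      M * (l z * (w x y * (df z x * df z y) * k3 (φ z) (φ x) (φ y))) := by unfold H3; ring
    nlinarith
  have b1 : ∑ x, ∑ y, w z y * (df y x * l x * k2 (φ y) (φ x)) ≤ l z * β := by
    rw [Finset.sum_comm]
    simp only [← Finset.mul_sum]
    calc _ ≤ ∑ y, w z y * β := Finset.sum_le_sum fun y _ => mul_le_mul_of_nonneg_left (hβ y) (w0 _ _)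
      _ = (∑ y, w z y) * β := by rw [Finset.sum_mul]
      _ ≤ _ := mul_le_mul_of_nonneg_right hl hβ0
  calc _ ≤ ∑ x, ∑ y, (M * (l z * (w x y * k2 (φ x) (φ y))) - M * (l z * (w x y * (df z x * df z y) * k3 (φ z) (φ x) (φ y)))
       + 2 * M * (w z y * (df y x * l x * k2 (φ y) (φ x)))) :=
        Finset.sum_le_sum fun x _ => Finset.sum_le_sum fun y _ => step x y
    _ = M * (l z * (∑ x, gg w k2 φ x)) - M * (l z * AA w k3 φ z) +
        2 * M * ∑ x, ∑ y, w z y * (df y x * l x * k2 (φ y) (φ x)) := by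
        simp only [Finset.sum_add_distrib, Finset.sum_sub_distrib, ← Finset.mul_sum, gg, AA]
    _ ≤ _ := by nlinarith [mul_le_mul_of_nonneg_left b1 hM0]

lemma D2_le (w : V → V → ℝ) (w0 : ∀ x y, 0 ≤ w x y) (ws : ∀ x y, w x y = w y x)
    (l : V → ℝ) (l0 : ∀ x, 0 ≤ l x) 
    (k2 : P → P → ℝ) (L : ℝ) (L0 : 0 ≤ L)
    (hk : ∀ q, ∑ p, k2 p q ≤ (Fintype.card P : ℝ) * L)
    (φ : V → P) (z : V)
    (hl : ∑ y, w z y ≤ l z) :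
    ∑ y, (H2 w l (∑ x, l x) z y + H2 w l (∑ x, l x) y z) *
        ((∑ p, k2 p (φ y)) - (Fintype.card P : ℝ) * k2 (φ z) (φ y))
      ≤ (Fintype.card P : ℝ) * (4 * l z * (∑ x, l x) * L - 2 * l z * BB l k2 φ z
          - 2 * (∑ x, l x) * gg w k2 φ z) := by
  set M : ℝ := (Fintype.card P : ℝ) with hM
  have hM0 : 0 ≤ M := by positivity
  set K := ∑ x, l x with hK
  have K0 : 0 ≤ K := Finset.sum_nonneg fun x _ => l0 x
  have step : ∀ y, (H2 w l K z y + H2 w l K y z) * ((∑ p, k2 p (φ y)) - M * k2 (φ z) (φ y)) ≤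
      2 * (M * L) * (l z * l y + K * w z y) -
      2 * M * l z * (df z y * l y * k2 (φ z) (φ y)) - 2 * M * K * (w z y * k2 (φ z) (φ y)) := by
    intro y
    have e : H2 w l K y z = H2 w l K z y := by unfold H2; rw [df_comm y z, ws y z]; ring
    rw [e]
    have h0 : 0 ≤ H2 w l K z y := by
      unfold H2
      have := df_nonneg z y
      have := w0 z y
      have := l0 z
      have := l0 y
      positivity
    have h1 : H2 w l K z y ≤ l z * l y + K * w z y := by
      unfold H2
      nlinarith [mul_le_mul_of_nonneg_right (df_le z y) (mul_nonneg (l0 z) (l0 y))]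
    have h2 := mul_le_mul_of_nonneg_left (hk (φ y)) h0
    have h3 := mul_le_mul_of_nonneg_right h1 (mul_nonneg hM0 L0)
    have h4 : H2 w l K z y * (M * k2 (φ z) (φ y)) =
      M * l z * (df z y * l y * k2 (φ z) (φ y)) + M * K * (w z y * k2 (φ z) (φ y)) := by
      unfold H2; ring
    nlinarith
  calc _ ≤ ∑ y, (2 * (M * L) * (l z * l y + K * w z y) -
      2 * M * l z * (df z y * l y * k2 (φ z) (φ y)) - 2 * M * K * (w z y * k2 (φ z) (φ y))) :=
        Finset.sum_le_sum fun y _ => step y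
    _ = 2 * (M * L) * (l z * K + K * ∑ y, w z y) - 2 * M * l z * BB l k2 φ z - 2 * M * K * gg w k2 φ z := by
        simp only [Finset.sum_add_distrib, Finset.sum_sub_distrib, ← Finset.mul_sum, gg, BB, hK]
    _ ≤ _ := by nlinarith [mul_le_mul_of_nonneg_left hl (mul_nonneg (mul_nonneg hM0 L0) K0)]

theorem minimize [Nonempty V] [Nonempty P]
    (w : V → V → ℝ) (w0 : ∀ x y, 0 ≤ w x y) (ws : ∀ x y, w x y = w y x) (wd : ∀ x, w x x = 0)
    (l : V → ℝ) (l0 : ∀ x, 0 < l x) (hl : ∀ z, ∑ y, w z y ≤ l z)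
    (k4 : P → P → P → P → ℝ) (k3 : P → P → P → ℝ) (k2 : P → P → ℝ) (L : ℝ)
    (ks : ∀ p q r s, k4 p q r s = k4 q p r s)
    (kt : ∀ p q r s, k4 p q r s = k4 p r q s) (ku : ∀ p q r s, k4 p q r s = k4 p q s r)
    (k4n : ∀ p q r s, 0 ≤ k4 p q r s)
    (k3n : ∀ p q r, 0 ≤ k3 p q r)
    (k3s : ∀ p q r, k3 p q r = k3 q p r) (k3t : ∀ p q r, k3 p q r = k3 p r q)
    (k2n : ∀ p q, 0 ≤ k2 p q)
    (k2s : ∀ p q, k2 p q = k2 q p) (L0 : 0 ≤ L)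
    (hk4 : ∀ q r s, ∑ p, k4 p q r s = (Fintype.card P : ℝ) * k3 q r s)
    (hk3 : ∀ q r, ∑ p, k3 p q r = (Fintype.card P : ℝ) * k2 q r)
    (hk2 : ∀ q, ∑ p, k2 p q ≤ (Fintype.card P : ℝ) * L) :
    ∃ φ : V → P, (∀ z, AA w k3 φ z ≤ 48 * (∑ x, l x) * L) ∧
      (∀ z, BB l k2 φ z ≤ 4 * (∑ x, l x) * L) ∧
      (∀ z, E4 w k4 φ z ≤ 768 * l z * (∑ x, l x) * L) := by
  set M : ℝ := (Fintype.card P : ℝ) with hM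
  have hMp : 0 < M := by rw [hM]; exact_mod_cast Fintype.card_pos
  set K := ∑ x, l x with hK
  have K0 : 0 < K := Finset.sum_pos (fun x _ => l0 x) Finset.univ_nonempty
  set Ψ4 : (V → P) → ℝ := fun φ => ∑ x, ∑ y, ∑ u, ∑ v, H4 w x y u v * k4 (φ x) (φ y) (φ u) (φ v) with h4
  set Ψ3 : (V → P) → ℝ := fun φ => ∑ x, ∑ y, ∑ u, H3 w l x y u * k3 (φ x) (φ y) (φ u) with h3
  set Ψ2 : (V → P) → ℝ := fun φ => ∑ x, ∑ y, H2 w l K x y * k2 (φ x) (φ y) with h2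
  obtain ⟨φ, hφ⟩ := Finite.exists_min (fun φ : V → P => Ψ4 φ + 16 * Ψ3 φ + 96 * Ψ2 φ)
  obtain ⟨x1, hα⟩ := Finite.exists_max (AA w k3 φ)
  obtain ⟨x2, hβ⟩ := Finite.exists_max (BB l k2 φ)
  have A0 : ∀ z, 0 ≤ AA w k3 φ z := by
    intro z
    unfold AA
    refine Finset.sum_nonneg fun x _ => Finset.sum_nonneg fun y _ => ?_
    have := df_nonneg z x
    have := df_nonneg z y
    have := w0 x y
    have := k3n (φ z) (φ x) (φ y)
    positivity
  have B0 : ∀ z, 0 ≤ BB l k2 φ z := by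
    intro z
    unfold BB
    refine Finset.sum_nonneg fun x _ => ?_
    have := df_nonneg z x
    have := l0 x
    have := k2n (φ z) (φ x)
    positivity
  have g0 : ∀ z, 0 ≤ gg w k2 φ z := by
    intro z
    unfold gg
    exact Finset.sum_nonneg fun x _ => mul_nonneg (w0 _ _) (k2n _ _)
  have E0 : ∀ z, 0 ≤ E4 w k4 φ z := by
    intro z
    unfold E4
    refine Finset.sum_nonneg fun x _ => Finset.sum_nonneg fun y _ => Finset.sum_nonneg fun u _ => ?_
    unfold H4
    have := df_nonneg z y
    have := df_nonneg z u
    have := df_nonneg x y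
    have := df_nonneg x u
    have := w0 z x
    have := w0 y u
    have := k4n (φ z) (φ x) (φ y) (φ u)
    positivity
  set α := AA w k3 φ x1 with hαd
  set β := BB l k2 φ x2 with hβd
  set Γ := ∑ x, gg w k2 φ x with hΓ
  have main : ∀ z, 0 ≤ (4 * l z * α - E4 w k4 φ z) +
      16 * (l z * Γ + 2 * l z * β - l z * AA w k3 φ z) +
      96 * (4 * l z * K * L - 2 * l z * BB l k2 φ z - 2 * K * gg w k2 φ z) := by
    intro z
    have m4 := mv4 k4 ks kt ku (H4 w) (by intros; simp [H4, wd]) (by intros; simp [H4, df_self])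
      (by intros; simp [H4, df_self]) (by intros; simp [H4, df_self]) (by intros; simp [H4, df_self])
      (by intros; simp [H4, wd]) φ z
    have m3 := mv3 k3 k3s k3t (H3 w l) (by intros; simp [H3, df_self]) (by intros; simp [H3, df_self])
      (by intros; simp [H3, wd]) φ z
    have m2 := mv2 k2 k2s (H2 w l K) (by intros; simp [H2, df_self, wd]) φ z
    have d4 := D4_le w w0 ws k4 k3 ks kt ku k4n k3n k3s k3t hk4 φ z α (l z) hα (A0 _) (hl z)
    have d3 := D3_le w w0 ws l (fun x => (l0 x).le) k3 k2 k3n k2n k2s hk3 φ z β hβ (B0 _) (hl z)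
    have d2 := D2_le w w0 ws l (fun x => (l0 x).le) k2 L L0 hk2 φ z (hl z)
    have avg : M * (Ψ4 φ + 16 * Ψ3 φ + 96 * Ψ2 φ) ≤
        ∑ p : P, (Ψ4 (Function.update φ z p) + 16 * Ψ3 (Function.update φ z p) +
          96 * Ψ2 (Function.update φ z p)) := by
      calc _ = ∑ p : P, (Ψ4 φ + 16 * Ψ3 φ + 96 * Ψ2 φ) := by
            rw [Finset.sum_const, Finset.card_univ, nsmul_eq_mul]
        _ ≤ _ := Finset.sum_le_sum fun p _ => hφ _
    rw [Finset.sum_add_distrib, Finset.sum_add_distrib, ← Finset.mul_sum, ← Finset.mul_sum] at avg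
    simp only [h4, h3, h2] at avg
    rw [m4, m3, m2] at avg
    have fin : 0 ≤ M * ((4 * l z * α - E4 w k4 φ z) +
      16 * (l z * Γ + 2 * l z * β - l z * AA w k3 φ z) +
      96 * (4 * l z * K * L - 2 * l z * BB l k2 φ z - 2 * K * gg w k2 φ z)) := by
      linarith
    exact nonneg_of_mul_nonneg_right fin hMp
  set ρ := 4 * α + 16 * Γ + 32 * β + 384 * K * L with hρ
  have main2 : ∀ z, E4 w k4 φ z + 16 * (l z * AA w k3 φ z) + 192 * (l z * BB l k2 φ z) +
      192 * (K * gg w k2 φ z) ≤ l z * ρ := by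
    intro z
    have := main z
    rw [hρ]
    linarith
  have hA : ∀ z, 16 * AA w k3 φ z ≤ ρ := by
    intro z
    refine le_of_mul_le_mul_left ?_ (l0 z)
    have := main2 z
    have := mul_nonneg (l0 z).le (B0 z)
    have := mul_nonneg K0.le (g0 z)
    have := E0 z
    linarith
  have hB : ∀ z, 192 * BB l k2 φ z ≤ ρ := by
    intro z
    refine le_of_mul_le_mul_left ?_ (l0 z)
    have := main2 z
    have := mul_nonneg (l0 z).le (A0 z)
    have := mul_nonneg K0.le (g0 z)
    have := E0 z
    linarith
  have hG : 192 * Γ ≤ ρ := by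
    refine le_of_mul_le_mul_left ?_ K0
    calc K * (192 * Γ) = ∑ z, 192 * (K * gg w k2 φ z) := by
          rw [hΓ, Finset.mul_sum, Finset.mul_sum]; exact Finset.sum_congr rfl fun _ _ => by ring
      _ ≤ ∑ z, l z * ρ := by
          refine Finset.sum_le_sum fun z _ => ?_
          have := main2 z
          have := mul_nonneg (l0 z).le (A0 z)
          have := mul_nonneg (l0 z).le (B0 z)
          have := E0 z
          linarith
      _ = K * ρ := by rw [hK, Finset.sum_mul]
  have hr : ρ ≤ 768 * (K * L) := by
    have := hA x1
    have := hB x2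
    rw [← hαd, ← hβd] at *
    linarith
  refine ⟨φ, fun z => ?_, fun z => ?_, fun z => ?_⟩
  · have := hA z
    linarith
  · have := hB z
    linarith
  · have := main2 z
    have := mul_nonneg (l0 z).le (A0 z)
    have := mul_nonneg (l0 z).le (B0 z)
    have := mul_nonneg K0.le (g0 z)
    have := mul_le_mul_of_nonneg_left hr (l0 z).le
    linarith

end Minimize
section Geo

lemma minor_zero {a b c d : ℤ} {t : ℝ} (ht : 0 < t)
    (h : t * ((a : ℝ) * b - c * d) = 0) : a * b - c * d = 0 := by
  have : ((a : ℝ) * b - c * d) = 0 := (mul_eq_zero.1 h).resolve_left ht.ne'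
  exact_mod_cast this

lemma col_of_seg (u v x : Fin 3 → ℤ) (s t : ℝ) (ht : 0 < t) (hst : s + t = 1)
    (e : ∀ i, s * (u i : ℝ) + t * (v i : ℝ) = (x i : ℝ)) :
    (u - x) 1 * (v - x) 2 - (u - x) 2 * (v - x) 1 = 0 ∧
    (u - x) 2 * (v - x) 0 - (u - x) 0 * (v - x) 2 = 0 ∧
    (u - x) 0 * (v - x) 1 - (u - x) 1 * (v - x) 0 = 0 := by
  have hs : s = 1 - t := by linarith
  subst hs
  have e' : ∀ i, t * (((v - x) i : ℤ) : ℝ) + (1 - t) * (((u - x) i : ℤ) : ℝ) = 0 := by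
    intro i
    have := e i
    simp only [Pi.sub_apply]
    push_cast
    linear_combination this
  refine ⟨minor_zero ht ?_, minor_zero ht ?_, minor_zero ht ?_⟩
  · linear_combination (((u - x) 1 : ℤ) : ℝ) * e' 2 - (((u - x) 2 : ℤ) : ℝ) * e' 1
  · linear_combination (((u - x) 2 : ℤ) : ℝ) * e' 0 - (((u - x) 0 : ℤ) : ℝ) * e' 2
  · linear_combination (((u - x) 0 : ℤ) : ℝ) * e' 1 - (((u - x) 1 : ℤ) : ℝ) * e' 0

lemma col_of_share (u v x : Fin 3 → ℤ) (s t s' t' : ℝ) (ht : 0 < t) (hst : s + t = 1)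
    (hst' : s' + t' = 1)
    (e : ∀ i, s * (u i : ℝ) + t * (v i : ℝ) = s' * (u i : ℝ) + t' * (x i : ℝ)) :
    (u - x) 1 * (v - x) 2 - (u - x) 2 * (v - x) 1 = 0 ∧
    (u - x) 2 * (v - x) 0 - (u - x) 0 * (v - x) 2 = 0 ∧
    (u - x) 0 * (v - x) 1 - (u - x) 1 * (v - x) 0 = 0 := by
  have hs : s = 1 - t := by linarith
  have hs' : s' = 1 - t' := by linarith
  subst hs hs'
  have e' : ∀ i, t * (((v - x) i : ℤ) : ℝ) - (t - t') * (((u - x) i : ℤ) : ℝ) = 0 := by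
    intro i
    have := e i
    simp only [Pi.sub_apply]
    push_cast
    linear_combination this
  refine ⟨minor_zero ht ?_, minor_zero ht ?_, minor_zero ht ?_⟩
  · linear_combination (((u - x) 1 : ℤ) : ℝ) * e' 2 - (((u - x) 2 : ℤ) : ℝ) * e' 1
  · linear_combination (((u - x) 2 : ℤ) : ℝ) * e' 0 - (((u - x) 0 : ℤ) : ℝ) * e' 2
  · linear_combination (((u - x) 0 : ℤ) : ℝ) * e' 1 - (((u - x) 1 : ℤ) : ℝ) * e' 0

lemma det_of_cross (u v x y : Fin 3 → ℤ) (s t s' t' : ℝ) (ht : 0 < t) (hst : s + t = 1)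
    (hst' : s' + t' = 1)
    (e : ∀ i, s * (u i : ℝ) + t * (v i : ℝ) = s' * (x i : ℝ) + t' * (y i : ℝ)) :
    dt (cr (v - u) (x - u)) (y - u) = 0 := by
  have hs : s = 1 - t := by linarith
  have hs' : s' = 1 - t' := by linarith
  subst hs hs'
  generalize ha : v - u = a
  generalize hb : x - u = b
  generalize hc : y - u = c
  have e' : ∀ i, t * ((a i : ℤ) : ℝ) - (1 - t') * (b i : ℝ) - t' * (c i : ℝ) = 0 := by
    intro i
    have := e i
    rw [← ha, ← hb, ← hc]
    simp only [Pi.sub_apply]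
    push_cast
    linear_combination this
  have key : t * ((dt (cr a b) c : ℤ) : ℝ) = 0 := by
    have hd : ((dt (cr a b) c : ℤ) : ℝ) = ((a 1 : ℝ) * b 2 - a 2 * b 1) * c 0 +
        ((a 2 : ℝ) * b 0 - a 0 * b 2) * c 1 + ((a 0 : ℝ) * b 1 - a 1 * b 0) * c 2 := by
      simp [dt, cr]
    rw [hd]
    linear_combination ((b 1 : ℝ) * c 2 - b 2 * c 1) * e' 0 + ((b 2 : ℝ) * c 0 - b 0 * c 2) * e' 1
      + ((b 0 : ℝ) * c 1 - b 1 * c 0) * e' 2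
  have := (mul_eq_zero.1 key).resolve_left ht.ne'
  exact_mod_cast this

end Geo
section Kernel

/-- four points determinant -/
def det4 (p q r s : Fin 3 → ℤ) : ℤ := dt (cr (q - p) (r - p)) (s - p)

lemma det4_12 (p q r s : Fin 3 → ℤ) : det4 p q r s = - det4 q p r s := by
  simp [det4, dt, cr]; ring
lemma det4_23 (p q r s : Fin 3 → ℤ) : det4 p q r s = - det4 p r q s := by
  simp [det4, dt, cr]; ring
lemma det4_34 (p q r s : Fin 3 → ℤ) : det4 p q r s = - det4 p q s r := by
  simp [det4, dt, cr]; ring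
lemma det4_col {p q r : Fin 3 → ℤ} (h : cr (q - p) (r - p) = 0) (t : Fin 3 → ℤ) :
    det4 t p q r = 0 := by
  rw [cr_eq_zero_iff] at h
  obtain ⟨h0, h1, h2⟩ := h
  simp only [Pi.sub_apply] at h0 h1 h2
  simp [det4, dt, cr]
  linear_combination (p 0 - t 0) * h0 + (p 1 - t 1) * h1 + (p 2 - t 2) * h2
lemma det4_self (t q p : Fin 3 → ℤ) : det4 t q p p = 0 := by
  simp [det4, dt, cr]; ring

/-- grid point as an integer vector -/
def tz {m : ℕ} (p : Fin 3 → Fin m) : Fin 3 → ℤ := fun i => ((p i : ℕ) : ℤ)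

lemma tz_inj {m : ℕ} : Function.Injective (tz (m := m)) := by
  intro p q h
  funext i
  have := congrFun h i
  simp only [tz] at this
  exact Fin.ext (by exact_mod_cast this)

def cop {m : ℕ} (p q r s : Fin 3 → Fin m) : ℝ := if det4 (tz p) (tz q) (tz r) (tz s) = 0 then 1 else 0

lemma cop_12 {m : ℕ} (p q r s : Fin 3 → Fin m) : cop p q r s = cop q p r s := by
  unfold cop; rw [det4_12]; simp
lemma cop_23 {m : ℕ} (p q r s : Fin 3 → Fin m) : cop p q r s = cop p r q s := by
  unfold cop; rw [det4_23]; simp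
lemma cop_34 {m : ℕ} (p q r s : Fin 3 → Fin m) : cop p q r s = cop p q s r := by
  unfold cop; rw [det4_34]; simp
lemma cop_nonneg {m : ℕ} (p q r s : Fin 3 → Fin m) : 0 ≤ cop p q r s := by
  unfold cop; split_ifs <;> norm_num

def kk4 {m : ℕ} (p q r s : Fin 3 → Fin m) : ℝ := (Fintype.card (Fin 3 → Fin m) : ℝ) * cop p q r s
def kk3 {m : ℕ} (q r s : Fin 3 → Fin m) : ℝ := ∑ p, cop p q r s
noncomputable def kk2 {m : ℕ} (r s : Fin 3 → Fin m) : ℝ :=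
  (∑ q, kk3 q r s) / (Fintype.card (Fin 3 → Fin m) : ℝ)

noncomputable def Lam (m : ℕ) : ℝ := 746496 * (1 + Real.log ((2 * m ^ 2 : ℕ) : ℝ))

lemma Lam_nonneg (m : ℕ) : 0 ≤ Lam m := by
  unfold Lam
  have := Real.log_natCast_nonneg (2 * m ^ 2)
  positivity

lemma cop_count {m : ℕ} (hm : 1 ≤ m) (s : Fin 3 → Fin m) :
    ∑ r, ∑ q, ∑ p, cop p q r s ≤ (m : ℝ) ^ 6 * Lam m := by
  classical
  have e : ∀ p q r : Fin 3 → Fin m, cop p q r s =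
      if dt (cr (tz r - tz s) (tz q - tz s)) (tz p - tz s) = 0 then 1 else 0 := by
    intro p q r
    rw [cop_34, cop_23, cop_12, cop_34, cop_23, cop_34]
    rfl
  have e2 : ∑ r, ∑ q, ∑ p, cop p q r s =
      ((Finset.univ.filter (fun t : (Fin 3 → Fin m) × (Fin 3 → Fin m) × (Fin 3 → Fin m) =>
        dt (cr (tz t.1 - tz s) (tz t.2.1 - tz s)) (tz t.2.2 - tz s) = 0)).card : ℝ) := by
    rw [Finset.card_filter]
    push_cast
    rw [Fintype.sum_prod_type]
    refine Finset.sum_congr rfl fun r _ => ?_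
    rw [Fintype.sum_prod_type]
    refine Finset.sum_congr rfl fun q _ => ?_
    refine Finset.sum_congr rfl fun p _ => ?_
    exact e p q r
  rw [e2]
  have hb : ∀ p : Fin 3 → Fin m, tz p - tz s ∈ Box m := by
    intro p
    rw [mem_Box]
    intro i
    have h1 := (p i).2
    have h2 := (s i).2
    simp only [tz, Pi.sub_apply]
    rw [abs_le]
    constructor <;> omega
  refine le_trans ?_ (le_of_le_of_eq (singular_count m hm) (by unfold Lam; ring))
  norm_cast
  refine Finset.card_le_card_of_injOn
    (fun t => (tz t.1 - tz s, tz t.2.1 - tz s, tz t.2.2 - tz s)) ?_ ?_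
  · intro t ht
    simp only [Finset.coe_filter, Finset.mem_univ, true_and, Set.mem_ofPred_eq] at ht
    simp only [Finset.coe_filter, Finset.mem_product, Set.mem_ofPred_eq]
    exact ⟨⟨hb _, hb _, hb _⟩, ht⟩
  · rintro ⟨a, b, c⟩ _ ⟨a', b', c'⟩ _ h
    simp only [Prod.mk.injEq, sub_left_inj] at h
    rw [tz_inj h.1, tz_inj h.2.1, tz_inj h.2.2]

theorem grid_min {V : Type} [Fintype V] [DecidableEq V] [Nonempty V] {m : ℕ} (hm : 1 ≤ m)
    (w : V → V → ℝ) (w0 : ∀ x y, 0 ≤ w x y) (ws : ∀ x y, w x y = w y x) (wd : ∀ x, w x x = 0)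
    (l : V → ℝ) (l0 : ∀ x, 0 < l x) (hl : ∀ z, ∑ y, w z y ≤ l z) :
    ∃ φ : V → (Fin 3 → Fin m), (∀ z, AA w kk3 φ z ≤ 48 * (∑ x, l x) * Lam m) ∧
      (∀ z, BB l kk2 φ z ≤ 4 * (∑ x, l x) * Lam m) ∧
      (∀ z, E4 w kk4 φ z ≤ 768 * l z * (∑ x, l x) * Lam m) := by
  have : Nonempty (Fin m) := ⟨⟨0, hm⟩⟩
  have hM : (0 : ℝ) < (Fintype.card (Fin 3 → Fin m) : ℝ) := by exact_mod_cast Fintype.card_pos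
  have hM3 : (Fintype.card (Fin 3 → Fin m) : ℝ) = (m : ℝ) ^ 3 := by simp
  have k3s : ∀ p q r : Fin 3 → Fin m, kk3 p q r = kk3 q p r := fun p q r =>
    Finset.sum_congr rfl fun t _ => cop_23 _ _ _ _
  have k3t : ∀ p q r : Fin 3 → Fin m, kk3 p q r = kk3 p r q := fun p q r =>
    Finset.sum_congr rfl fun t _ => cop_34 _ _ _ _
  have k3n : ∀ p q r : Fin 3 → Fin m, 0 ≤ kk3 p q r := fun p q r =>
    Finset.sum_nonneg fun t _ => cop_nonneg _ _ _ _
  refine minimize w w0 ws wd l l0 hl kk4 kk3 kk2 (Lam m) ?_ ?_ ?_ ?_ k3n k3s k3t ?_ ?_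
    (Lam_nonneg m) ?_ ?_ ?_
  · intro p q r s; unfold kk4; rw [cop_12]
  · intro p q r s; unfold kk4; rw [cop_23]
  · intro p q r s; unfold kk4; rw [cop_34]
  · intro p q r s; exact mul_nonneg hM.le (cop_nonneg _ _ _ _)
  · intro p q; exact div_nonneg (Finset.sum_nonneg fun _ _ => k3n _ _ _) hM.le
  · intro p q
    unfold kk2
    congr 1
    exact Finset.sum_congr rfl fun t _ => k3t _ _ _
  · intro q r s; unfold kk4 kk3; rw [Finset.mul_sum]
  · intro q r; unfold kk2; field_simp
  · intro s
    unfold kk2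
    rw [← Finset.sum_div, div_le_iff₀ hM]
    refine le_trans (cop_count hm s) ?_
    rw [hM3]
    apply le_of_eq; ring

theorem grid_draw {n m : ℕ} (hn : 0 < n) (hm : 1 ≤ m) (G : SimpleGraph (Fin n))
    (w : Fin n → Fin n → ℝ) (w0 : ∀ x y, 0 ≤ w x y) (ws : ∀ x y, w x y = w y x)
    (wd : ∀ x, w x x = 0) (wa : ∀ x y, G.Adj x y → 1 ≤ w x y)
    (l : Fin n → ℝ) (l1 : ∀ x, 1 ≤ l x) (hl : ∀ z, ∑ y, w z y ≤ l z)
    (T : ℝ) (hT : 1 ≤ T) (hlT : ∀ x y, G.Adj x y → l x ≤ T * w x y ∨ l y ≤ T * w x y)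
    (hbig : 768 * T * (∑ x, l x) * Lam m < (m : ℝ) ^ 3) :
    ∃ φ : Fin n → (Fin 3 → ℤ), IsGridDrawing m G φ := by
  have : Nonempty (Fin n) := ⟨⟨0, hn⟩⟩
  have : Nonempty (Fin m) := ⟨⟨0, hm⟩⟩
  obtain ⟨ψ, hA, hB, hE⟩ := grid_min hm w w0 ws wd l (fun x => lt_of_lt_of_le one_pos (l1 x)) hl
  set K := ∑ x, l x with hK
  have K0 : 0 ≤ K := Finset.sum_nonneg fun x _ => le_trans zero_le_one (l1 x)
  have hM3 : (Fintype.card (Fin 3 → Fin m) : ℝ) = (m : ℝ) ^ 3 := by simp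
  have hM : (0 : ℝ) < (m : ℝ) ^ 3 := by positivity
  have KL : 0 ≤ K * Lam m := mul_nonneg K0 (Lam_nonneg m)
  have KLM : 768 * (K * Lam m) < (m : ℝ) ^ 3 := by nlinarith
  have df1 : ∀ {x y : Fin n}, x ≠ y → df x y = 1 := fun h => by simp [df, h]
  have k3n : ∀ p q r : Fin 3 → Fin m, 0 ≤ kk3 p q r := fun p q r =>
    Finset.sum_nonneg fun t _ => cop_nonneg _ _ _ _
  have k2n : ∀ p q : Fin 3 → Fin m, 0 ≤ kk2 p q := fun p q =>
    div_nonneg (Finset.sum_nonneg fun _ _ => k3n _ _ _) (by positivity)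
  have inj : Function.Injective ψ := by
    intro x u hxu
    by_contra hne
    have h1 : kk2 (ψ x) (ψ u) = (m : ℝ) ^ 3 := by
      unfold kk2 kk3 cop
      rw [hxu]
      simp only [det4_self, if_true, Finset.sum_const, Finset.card_univ, nsmul_eq_mul, hM3]
      field_simp
    have h2 : df x u * l u * kk2 (ψ x) (ψ u) ≤ BB l kk2 ψ x := by
      unfold BB
      refine Finset.single_le_sum (f := fun u => df x u * l u * kk2 (ψ x) (ψ u)) (fun y _ => ?_)
        (Finset.mem_univ u)
      exact mul_nonneg (mul_nonneg (df_nonneg _ _) (le_trans zero_le_one (l1 y))) (k2n _ _)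
    rw [df1 hne, h1] at h2
    have := hB x
    nlinarith [l1 u]
  have col : ∀ u v x, G.Adj u v → x ≠ u → x ≠ v →
      cr (tz (ψ u) - tz (ψ x)) (tz (ψ v) - tz (ψ x)) ≠ 0 := by
    intro u v x huv hxu hxv h0
    have h1 : kk3 (ψ x) (ψ u) (ψ v) = (m : ℝ) ^ 3 := by
      unfold kk3 cop
      simp only [det4_col h0, if_true, Finset.sum_const, Finset.card_univ, nsmul_eq_mul, hM3, mul_one]
    have nn : ∀ y u, 0 ≤ w y u * (df x y * df x u) * kk3 (ψ x) (ψ y) (ψ u) := fun y u =>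
      mul_nonneg (mul_nonneg (w0 _ _) (mul_nonneg (df_nonneg _ _) (df_nonneg _ _))) (k3n _ _ _)
    have h2 : w u v * (df x u * df x v) * kk3 (ψ x) (ψ u) (ψ v) ≤ AA w kk3 ψ x := by
      unfold AA
      refine le_trans ?_ (Finset.single_le_sum (fun y _ => Finset.sum_nonneg fun v _ => nn y v)
        (Finset.mem_univ u))
      exact Finset.single_le_sum (f := fun v => w u v * (df x u * df x v) * kk3 (ψ x) (ψ u) (ψ v))
        (fun v _ => nn u v) (Finset.mem_univ v)
    rw [df1 hxu, df1 hxv, h1] at h2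
    have := hA x
    nlinarith [wa u v huv]
  have cp : ∀ x y u v, G.Adj x y → G.Adj u v → x ≠ u → x ≠ v → y ≠ u → y ≠ v →
      l x ≤ T * w x y → det4 (tz (ψ x)) (tz (ψ y)) (tz (ψ u)) (tz (ψ v)) ≠ 0 := by
    intro x y u v hxy huv h1 h2 h3 h4 hx h0
    have h5 : kk4 (ψ x) (ψ y) (ψ u) (ψ v) = (m : ℝ) ^ 3 := by
      unfold kk4 cop
      rw [if_pos h0, hM3, mul_one]
    have nn : ∀ y u v, 0 ≤ H4 w x y u v * kk4 (ψ x) (ψ y) (ψ u) (ψ v) := fun y u v => by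
      refine mul_nonneg (mul_nonneg (mul_nonneg (w0 _ _) (w0 _ _)) ?_)
        (mul_nonneg (by positivity) (cop_nonneg _ _ _ _))
      exact mul_nonneg (mul_nonneg (mul_nonneg (df_nonneg _ _) (df_nonneg _ _)) (df_nonneg _ _))
        (df_nonneg _ _)
    have h6 : H4 w x y u v * kk4 (ψ x) (ψ y) (ψ u) (ψ v) ≤ E4 w kk4 ψ x := by
      unfold E4
      refine le_trans ?_ (Finset.single_le_sum (fun y _ => Finset.sum_nonneg fun u _ =>
        Finset.sum_nonneg fun v _ => nn y u v) (Finset.mem_univ y))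
      refine le_trans ?_ (Finset.single_le_sum (fun u _ =>
        Finset.sum_nonneg fun v _ => nn y u v) (Finset.mem_univ u))
      exact Finset.single_le_sum (f := fun v => H4 w x y u v * kk4 (ψ x) (ψ y) (ψ u) (ψ v))
        (fun v _ => nn y u v) (Finset.mem_univ v)
    unfold H4 at h6
    rw [df1 h1, df1 h2, df1 h3, df1 h4, h5] at h6
    have h7 := hE x
    have h8 := wa x y hxy
    have h9 := wa u v huv
    have h10 : l x * (K * Lam m) ≤ T * w x y * (K * Lam m) := mul_le_mul_of_nonneg_right hx KL
    have h11 : w x y * (768 * T * K * Lam m) < w x y * (m : ℝ) ^ 3 :=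
      mul_lt_mul_of_pos_left hbig (by linarith)
    have h12 : w x y * 1 * (m : ℝ) ^ 3 ≤ w x y * w u v * (m : ℝ) ^ 3 := by
      apply mul_le_mul_of_nonneg_right _ hM.le
      exact mul_le_mul_of_nonneg_left h9 (w0 _ _)
    nlinarith
  have cp' : ∀ x y u v, G.Adj x y → G.Adj u v → x ≠ u → x ≠ v → y ≠ u → y ≠ v →
      det4 (tz (ψ x)) (tz (ψ y)) (tz (ψ u)) (tz (ψ v)) ≠ 0 := by
    intro x y u v hxy huv h1 h2 h3 h4
    rcases hlT x y hxy with h | h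
    · exact cp x y u v hxy huv h1 h2 h3 h4 h
    · rw [det4_12, neg_ne_zero]
      exact cp y x u v hxy.symm huv h3 h4 h1 h2 (by rw [ws y x]; exact h)
  refine ⟨fun v => tz (ψ v), fun x y h => inj (tz_inj h), ?_, ?_, ?_⟩
  · intro v i
    have := (ψ v i).2
    simp only [tz]
    constructor <;> omega
  · intro u v x huv hxu hxv hmem
    obtain ⟨s, t, hs, ht, hst, he⟩ := hmem
    apply col u v x huv hxu hxv
    have e : ∀ i, s * ((tz (ψ u) i : ℤ) : ℝ) + t * ((tz (ψ v) i : ℤ) : ℝ) = ((tz (ψ x) i : ℤ) : ℝ) :=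
      fun i => by simpa using congrFun he i
    rw [cr_eq_zero_iff]
    exact col_of_seg _ _ _ s t ht hst e
  · have share : ∀ u v v', G.Adj u v → G.Adj u v' → v ≠ v' → ∀ p : Fin 3 → ℝ,
        p ∈ openSegment ℝ (fun i => ((tz (ψ u) i : ℤ) : ℝ)) (fun i => ((tz (ψ v) i : ℤ) : ℝ)) →
        p ∈ openSegment ℝ (fun i => ((tz (ψ u) i : ℤ) : ℝ)) (fun i => ((tz (ψ v') i : ℤ) : ℝ)) →
        False := by
      intro u v v' h1 h2 hne p ⟨s, t, hs, ht, hst, he⟩ ⟨s', t', hs', ht', hst', he'⟩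
      apply col u v v' h1 h2.ne' hne.symm
      have e : ∀ i, s * ((tz (ψ u) i : ℤ) : ℝ) + t * ((tz (ψ v) i : ℤ) : ℝ) =
          s' * ((tz (ψ u) i : ℤ) : ℝ) + t' * ((tz (ψ v') i : ℤ) : ℝ) :=
        fun i => by simpa using congrFun (he.trans he'.symm) i
      rw [cr_eq_zero_iff]
      exact col_of_share _ _ _ s t s' t' ht hst hst' e
    intro u v u' v' h1 h2 hne
    rw [Set.eq_empty_iff_forall_notMem]
    rintro p ⟨hp, hp'⟩
    by_cases c1 : u = u'
    · subst c1
      exact share u v v' h1 h2 (by rintro rfl; exact hne rfl) p hp hp'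
    by_cases c2 : v = v'
    · subst c2
      rw [openSegment_symm] at hp hp'
      exact share v u u' h1.symm h2.symm c1 p hp hp'
    by_cases c3 : u = v'
    · subst c3
      rw [openSegment_symm ℝ (fun i => ((tz (ψ u') i : ℤ) : ℝ))] at hp'
      exact share u v u' h1 h2.symm (by rintro rfl; exact hne Sym2.eq_swap) p hp hp'
    by_cases c4 : v = u'
    · subst c4
      rw [openSegment_symm] at hp
      exact share v u v' h1.symm h2 c3 p hp hp'
    apply cp' u v u' v' h1 h2 c1 c3 c4 c2
    obtain ⟨s, t, hs, ht, hst, he⟩ := hp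
    obtain ⟨s', t', hs', ht', hst', he'⟩ := hp'
    have e : ∀ i, s * ((tz (ψ u) i : ℤ) : ℝ) + t * ((tz (ψ v) i : ℤ) : ℝ) =
        s' * ((tz (ψ u') i : ℤ) : ℝ) + t' * ((tz (ψ v') i : ℤ) : ℝ) :=
      fun i => by simpa using congrFun (he.trans he'.symm) i
    exact det_of_cross _ _ _ _ s t s' t' ht hst hst' e

end Kernel
section Weights
open Classical in
/-- the number of earlier neighbours -/
noncomputable def bk {n : ℕ} (G : SimpleGraph (Fin n)) (r : Fin n → ℕ) (v : Fin n) : ℕ :=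
  (Finset.univ.filter (fun u => G.Adj v u ∧ r u < r v)).card

open Classical in
noncomputable def ee {n : ℕ} (G : SimpleGraph (Fin n)) (r : Fin n → ℕ) (x y : Fin n) : ℝ :=
  if G.Adj x y ∧ r x < r y then 1 else 0

lemma ee_nonneg {n : ℕ} (G : SimpleGraph (Fin n)) (r : Fin n → ℕ) (x y : Fin n) :
    0 ≤ ee G r x y := by unfold ee; split_ifs <;> norm_num

lemma bk_eq {n : ℕ} (G : SimpleGraph (Fin n)) (r : Fin n → ℕ) (v : Fin n) :
    (bk G r v : ℝ) = ∑ u, ee G r u v := by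
  classical
  unfold bk ee
  rw [Finset.card_filter]
  push_cast
  refine Finset.sum_congr rfl fun u _ => ?_
  simp only [G.adj_comm v u]

theorem rank_exists {n D : ℕ} (G : SimpleGraph (Fin n))
    (h : ∀ s : Finset (Fin n), s.Nonempty → ∃ v ∈ s, {u | u ∈ s ∧ G.Adj v u}.ncard ≤ D) :
    ∃ r : Fin n → ℕ, Function.Injective r ∧ ∀ v, bk G r v ≤ D := by
  classical
  have key : ∀ N, ∀ s : Finset (Fin n), s.card = N → ∃ r : Fin n → ℕ, Set.InjOn r s ∧
      ∀ v ∈ s, (s.filter (fun u => G.Adj v u ∧ r u < r v)).card ≤ D := by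
    intro N
    induction N with
    | zero =>
      intro s hs
      rw [Finset.card_eq_zero] at hs
      subst hs
      exact ⟨fun _ => 0, by simp, by simp⟩
    | succ N ih =>
      intro s hs
      obtain ⟨v, hv, hd⟩ := h s (by rw [← Finset.card_pos]; omega)
      obtain ⟨r, hr, hb⟩ := ih (s.erase v) (by rw [Finset.card_erase_of_mem hv]; omega)
      set M := s.sup r + 1 with hM
      have hlt : ∀ u ∈ s, r u < M := fun u hu => Nat.lt_succ_of_le (Finset.le_sup hu)
      refine ⟨Function.update r v M, ?_, ?_⟩
      · intro x hx y hy hxy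
        have hx : x ∈ s := hx
        have hy : y ∈ s := hy
        by_cases h1 : x = v
        · by_cases h2 : y = v
          · rw [h1, h2]
          · rw [h1, Function.update_self, Function.update_of_ne h2] at hxy
            have := hlt y hy
            omega
        · by_cases h2 : y = v
          · rw [h2, Function.update_self, Function.update_of_ne h1] at hxy
            have := hlt x hx
            omega
          · rw [Function.update_of_ne h1, Function.update_of_ne h2] at hxy
            exact hr (by simp [h1, hx]) (by simp [h2, hy]) hxy
      · intro x hx
        by_cases h1 : x = v
        · subst h1
          refine le_trans (Finset.card_le_card (t := s.filter (fun u => G.Adj x u)) ?_) ?_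
          · intro u hu
            simp only [Finset.mem_filter] at hu ⊢
            exact ⟨hu.1, hu.2.1⟩
          · refine le_trans (le_of_eq ?_) hd
            rw [← Set.ncard_coe_finset]
            congr 1
            ext u
            simp
        · refine le_trans (Finset.card_le_card ?_) (hb x (by simp [h1, hx]))
          intro u hu
          simp only [Finset.mem_filter, Finset.mem_erase] at hu ⊢
          rw [Function.update_of_ne h1] at hu
          by_cases h2 : u = v
          · rw [h2, Function.update_self] at hu
            have := hlt x hx
            omega
          · rw [Function.update_of_ne h2] at hu
            exact ⟨⟨h2, hu.1⟩, hu.2⟩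
  obtain ⟨r, hr, hb⟩ := key _ Finset.univ rfl
  refine ⟨r, fun x y hxy => hr (by simp) (by simp) hxy, fun v => ?_⟩
  have := hb v (Finset.mem_univ v)
  unfold bk
  convert this

theorem omega_exists {n : ℕ} (G : SimpleGraph (Fin n)) (r : Fin n → ℕ) (c : ℝ) (hc : 0 ≤ c) :
    ∃ Ω : Fin n → ℝ, (∀ z, Ω z = 1 + c * ∑ v, ee G r z v * Ω v) ∧ ∀ z, 1 ≤ Ω z := by
  classical
  have wf : WellFounded (fun a b : Fin n => r b < r a) := by
    have : IsTrans (Fin n) (fun a b : Fin n => r b < r a) := ⟨fun a b c h1 h2 => lt_trans h2 h1⟩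
    have : Std.Irrefl (fun a b : Fin n => r b < r a) := ⟨fun a h => lt_irrefl _ h⟩
    exact Finite.wellFounded_of_trans_of_irrefl _
  let F : (z : Fin n) → ((y : Fin n) → r z < r y → ℝ) → ℝ := fun z rec =>
    1 + c * ∑ v, if h : G.Adj z v ∧ r z < r v then rec v h.2 else 0
  let Ω := wf.fix F
  have eq : ∀ z, Ω z = 1 + c * ∑ v, ee G r z v * Ω v := by
    intro z
    have : Ω z = F z (fun y _ => Ω y) := wf.fix_eq F z
    rw [this]
    simp only [F, ee]
    congr 2
    refine Finset.sum_congr rfl fun v _ => ?_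
    split_ifs <;> simp
  refine ⟨Ω, eq, ?_⟩
  intro z
  induction z using wf.induction with
  | _ z ih =>
    rw [eq z]
    have : 0 ≤ ∑ v, ee G r z v * Ω v := by
      refine Finset.sum_nonneg fun v _ => ?_
      by_cases h : r z < r v
      · exact mul_nonneg (ee_nonneg _ _ _ _) (le_trans zero_le_one (ih v h))
      · simp [ee, h]
    nlinarith [mul_nonneg hc this]

theorem core {n m D : ℕ} (hn : 0 < n) (hm : 1 ≤ m) (hD : 1 ≤ D) (G : SimpleGraph (Fin n))
    (r : Fin n → ℕ) (hr : Function.Injective r) (hb : ∀ v, bk G r v ≤ D) (k : ℕ) (hnk : n ≤ k)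
    (hk : ∑ v, bk G r v ≤ k)
    (hbig : 768 * (3 * (D : ℝ)) * (5 * k) * Lam m < (m : ℝ) ^ 3) :
    ∃ φ : Fin n → (Fin 3 → ℤ), IsGridDrawing m G φ := by
  have hDr : (1 : ℝ) ≤ D := by exact_mod_cast hD
  have hD0 : (0 : ℝ) < D := by linarith
  obtain ⟨Ω, hΩ, hΩ1⟩ := omega_exists G r (1 / (2 * D)) (by positivity)
  have hΩ0 : ∀ z, 0 ≤ Ω z := fun z => le_trans zero_le_one (hΩ1 z)
  have e0 := ee_nonneg G r
  set w : Fin n → Fin n → ℝ := fun x y => ee G r x y * Ω y + ee G r y x * Ω x with hw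
  have w0 : ∀ x y, 0 ≤ w x y := fun x y =>
    add_nonneg (mul_nonneg (e0 _ _) (hΩ0 _)) (mul_nonneg (e0 _ _) (hΩ0 _))
  have hbr : ∀ v, ∑ u, ee G r u v ≤ D := fun v => by
    rw [← bk_eq]; exact_mod_cast hb v
  have fwd : ∀ z, ∑ v, ee G r z v * Ω v = 2 * D * (Ω z - 1) := by
    intro z
    have := hΩ z
    rw [this]; field_simp; ring
  have Wz : ∀ z, ∑ y, w z y = 2 * D * (Ω z - 1) + (∑ u, ee G r u z) * Ω z := by
    intro z
    simp only [hw, Finset.sum_add_distrib, fwd, Finset.sum_mul]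
  set l : Fin n → ℝ := fun z => 1 + ∑ y, w z y with hl
  have lT : ∀ z, l z ≤ 3 * D * Ω z := by
    intro z
    simp only [hl, Wz]
    nlinarith [mul_le_mul_of_nonneg_right (hbr z) (hΩ0 z)]
  have cases : ∀ x y, G.Adj x y → ee G r x y = 1 ∨ ee G r y x = 1 := by
    intro x y h
    rcases lt_trichotomy (r x) (r y) with h1 | h1 | h1
    · left; simp [ee, h, h1]
    · exact absurd (hr h1) h.ne
    · right; simp [ee, h.symm, h1]
  have Kb : ∑ z, l z ≤ 5 * k := by
    set S := ∑ z, (∑ u, ee G r u z) * Ω z with hS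
    have S1 : ∑ z, ∑ v, ee G r z v * Ω v = S := by
      rw [Finset.sum_comm]
      simp only [hS, Finset.sum_mul]
    have S2 : S ≤ 2 * ∑ v, (bk G r v : ℝ) := by
      have : S ≤ ∑ v, (bk G r v : ℝ) + (1 / 2) * S := by
        calc S = ∑ z, ((bk G r z : ℝ) + (∑ u, ee G r u z) * (1 / (2 * D) * ∑ v, ee G r z v * Ω v)) := by
              rw [hS]
              refine Finset.sum_congr rfl fun z _ => ?_
              rw [bk_eq]
              conv_lhs => rw [hΩ z]
              ring
          _ ≤ ∑ z, ((bk G r z : ℝ) + D * (1 / (2 * D) * ∑ v, ee G r z v * Ω v)) := by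
              refine Finset.sum_le_sum fun z _ => ?_
              have : 0 ≤ 1 / (2 * (D : ℝ)) * ∑ v, ee G r z v * Ω v :=
                mul_nonneg (by positivity)
                  (Finset.sum_nonneg fun v _ => mul_nonneg (e0 _ _) (hΩ0 _))
              have := mul_le_mul_of_nonneg_right (hbr z) this
              linarith
          _ = ∑ z, ((bk G r z : ℝ) + (1 / 2) * ∑ v, ee G r z v * Ω v) := by
              refine Finset.sum_congr rfl fun z _ => ?_
              field_simp
          _ = _ := by rw [Finset.sum_add_distrib, ← Finset.mul_sum, S1]
      linarith
    have S3 : ∑ z, l z = n + 2 * S := by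
      simp only [hl, hw, Finset.sum_add_distrib, S1]
      have : ∑ x, ∑ y, ee G r y x * Ω x = S := by simp only [hS, Finset.sum_mul]
      rw [this]
      simp
      ring
    have h1 : ∑ v, (bk G r v : ℝ) ≤ k := by exact_mod_cast hk
    have h2 : (n : ℝ) ≤ k := by exact_mod_cast hnk
    linarith
  refine grid_draw hn hm G w w0 (fun x y => add_comm _ _) ?_ ?_ l ?_ ?_ (3 * D) (by linarith) ?_ ?_
  · intro x; simp [hw, ee]
  · intro x y h
    rcases cases x y h with h1 | h1
    · have := mul_nonneg (e0 y x) (hΩ0 x)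
      simp only [hw, h1]
      linarith [hΩ1 y]
    · have := mul_nonneg (e0 x y) (hΩ0 y)
      simp only [hw, h1]
      linarith [hΩ1 x]
  · intro x
    have : 0 ≤ ∑ y, w x y := Finset.sum_nonneg fun y _ => w0 _ _
    simp only [hl]; linarith
  · intro z; simp only [hl]; linarith
  · intro x y h
    rcases cases x y h with h1 | h1
    · right
      refine le_trans (lT y) (mul_le_mul_of_nonneg_left ?_ (by positivity))
      have := mul_nonneg (e0 y x) (hΩ0 x)
      simp only [hw, h1]
      linarith
    · left
      refine le_trans (lT x) (mul_le_mul_of_nonneg_left ?_ (by positivity))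
      have := mul_nonneg (e0 x y) (hΩ0 y)
      simp only [hw, h1]
      linarith
  · refine lt_of_le_of_lt ?_ hbig
    have := mul_le_mul_of_nonneg_left Kb (mul_nonneg hD0.le (Lam_nonneg m))
    nlinarith

theorem choose_m {n D k : ℕ} (hn : 2 ≤ n) (hD : 1 ≤ D) (hDn : D ≤ n) (hnk : n ≤ k)
    (hk : k ≤ n ^ 2) :
    ∃ m : ℕ, 1 ≤ m ∧ (m : ℝ) ^ 3 ≤ 2 ^ 43 * D * k * Real.log n ∧
      768 * (3 * (D : ℝ)) * (5 * k) * Lam m < (m : ℝ) ^ 3 := by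
  have hnr : (2 : ℝ) ≤ n := by exact_mod_cast hn
  have hDr : (1 : ℝ) ≤ D := by exact_mod_cast hD
  have hDnr : (D : ℝ) ≤ n := by exact_mod_cast hDn
  have hnkr : (n : ℝ) ≤ k := by exact_mod_cast hnk
  have hkr : (k : ℝ) ≤ (n : ℝ) ^ 2 := by exact_mod_cast hk
  have l2 := Real.log_two_gt_d9
  have l2' := Real.log_two_lt_d9
  have ln2 : Real.log 2 ≤ Real.log n := Real.log_le_log (by norm_num) hnr
  have lnn : Real.log n ≤ n := (Real.log_le_sub_one_of_pos (by linarith)).trans (by linarith)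
  set Y : ℝ := D * k * Real.log n with hY
  have hDk : (2 : ℝ) ≤ D * k := by nlinarith
  have hY1 : 1 ≤ Y := by rw [hY]; nlinarith
  have hYn : Y ≤ (n : ℝ) ^ 4 := by
    calc Y ≤ n * n ^ 2 * n := by
          rw [hY]; gcongr
      _ = _ := by ring
  set X : ℝ := 2 ^ 43 * Y with hX
  have hX1 : 1 ≤ X := by rw [hX]; linarith
  set x : ℝ := X ^ ((1 : ℝ) / 3) with hx
  have hx3 : x ^ 3 = X := by
    rw [hx, ← Real.rpow_natCast, ← Real.rpow_mul (by linarith)]; norm_num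
  have hx1 : 1 ≤ x := Real.one_le_rpow hX1 (by norm_num)
  set m := ⌊x⌋₊ with hm
  have hm1 : 1 ≤ m := Nat.le_floor (by exact_mod_cast hx1)
  have hmr : (1 : ℝ) ≤ m := by exact_mod_cast hm1
  have hmx : (m : ℝ) ≤ x := Nat.floor_le (by linarith)
  have hxm : x < m + 1 := Nat.lt_floor_add_one x
  have hm3 : (m : ℝ) ^ 3 ≤ X := by rw [← hx3]; gcongr
  have hX8 : X ≤ 8 * (m : ℝ) ^ 3 := by
    calc X = x ^ 3 := hx3.symm
      _ ≤ (2 * (m : ℝ)) ^ 3 := by gcongr; linarith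
      _ = _ := by ring
  have logX : Real.log X ≤ 43 * Real.log 2 + 4 * Real.log n := by
    calc Real.log X ≤ Real.log (2 ^ 43 * (n : ℝ) ^ 4) := by
          apply Real.log_le_log (by linarith)
          rw [hX]; linarith
      _ = _ := by
          rw [Real.log_mul (by positivity) (by positivity), Real.log_pow, Real.log_pow]; norm_num
  have logm : 3 * Real.log m ≤ Real.log X := by
    have : Real.log ((m : ℝ) ^ 3) ≤ Real.log X := Real.log_le_log (by positivity) hm3
    rw [Real.log_pow] at this
    exact_mod_cast this
  have lamm : Lam m ≤ 746496 * (36 * Real.log n) := by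
    unfold Lam
    have : Real.log ((2 * m ^ 2 : ℕ) : ℝ) = Real.log 2 + 2 * Real.log m := by
      push_cast
      rw [Real.log_mul (by norm_num) (by positivity), Real.log_pow]; norm_num
    rw [this]
    linarith
  refine ⟨m, hm1, le_of_le_of_eq hm3 (by rw [hX, hY]; ring), ?_⟩
  have f : 768 * (3 * (D : ℝ)) * (5 * k) * Lam m ≤ 768 * (3 * (D : ℝ)) * (5 * k) * (746496 * (36 * Real.log n)) :=
    mul_le_mul_of_nonneg_left lamm (by positivity)
  have f2 : 768 * (3 * (D : ℝ)) * (5 * k) * (746496 * (36 * Real.log n)) =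
    (768 * 3 * 5 * 746496 * 36) * Y := by rw [hY]; ring
  rw [f2] at f
  have : X = 2 ^ 43 * Y := hX
  norm_num at this f
  linarith

theorem core2 {n D : ℕ} (hn : 2 ≤ n) (hD : 1 ≤ D) (hDn : D ≤ n) (G : SimpleGraph (Fin n))
    (r : Fin n → ℕ) (hr : Function.Injective r) (hb : ∀ v, bk G r v ≤ D) (k : ℕ) (hnk : n ≤ k)
    (hk : ∑ v, bk G r v ≤ k) (hkn : k ≤ n ^ 2) :
    ∃ m : ℕ, (m : ℝ) ^ 3 ≤ 2 ^ 43 * D * k * Real.log n ∧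
      ∃ φ : Fin n → (Fin 3 → ℤ), IsGridDrawing m G φ := by
  obtain ⟨m, hm, h1, h2⟩ := choose_m hn hD hDn hnk hkn
  exact ⟨m, h1, core (by omega) hm hD G r hr hb k hnk hk h2⟩

lemma bk_le_n {n : ℕ} (G : SimpleGraph (Fin n)) (r : Fin n → ℕ) (v : Fin n) : bk G r v ≤ n := by
  unfold bk
  refine le_trans (Finset.card_le_univ _) (by simp)

lemma bk_le_deg {n : ℕ} (G : SimpleGraph (Fin n)) (r : Fin n → ℕ) (v : Fin n) :
    bk G r v ≤ {u | G.Adj v u}.ncard := by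
  classical
  unfold bk
  rw [← Set.ncard_coe_finset]
  apply Set.ncard_le_ncard
  · intro u hu
    simp at hu
    exact hu.1
  · exact Set.toFinite _

lemma bk_sum {n : ℕ} (G : SimpleGraph (Fin n)) (r : Fin n → ℕ) (hr : Function.Injective r) :
    ∑ v, bk G r v = Nat.card G.edgeSet := by
  classical
  have h1 := G.sum_degrees_eq_twice_card_edges
  have h2 : G.edgeFinset.card = Nat.card G.edgeSet := by
    rw [Nat.card_eq_fintype_card, ← SimpleGraph.edgeFinset_card]
  have h3 : ∀ v, (G.degree v : ℝ) = ∑ u, (ee G r u v + ee G r v u) := by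
    intro v
    rw [← SimpleGraph.card_neighborFinset_eq_degree, SimpleGraph.neighborFinset_eq_filter,
      Finset.card_filter]
    push_cast
    refine Finset.sum_congr rfl fun u _ => ?_
    unfold ee
    by_cases h : G.Adj v u
    · rcases lt_trichotomy (r v) (r u) with h1 | h1 | h1
      · simp [h, h.symm, h1, h1.le, not_lt.2 h1.le]
      · exact absurd (hr h1) h.ne
      · simp [h, h.symm, h1, not_lt.2 h1.le]
    · have : ¬ G.Adj u v := fun h' => h h'.symm
      simp [h, this]
  have h4 : (∑ v, (G.degree v : ℝ)) = 2 * ∑ v, (bk G r v : ℝ) := by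
    simp only [h3, Finset.sum_add_distrib, bk_eq]
    rw [Finset.sum_comm (f := fun v u => ee G r v u)]
    ring
  have h5 : (∑ v, (G.degree v : ℝ)) = 2 * (Nat.card G.edgeSet : ℝ) := by
    rw [← h2]; exact_mod_cast h1
  have : (∑ v, (bk G r v : ℝ)) = Nat.card G.edgeSet := by linarith
  exact_mod_cast this

end Weights
end GD

theorem stmt17 :
    (∃ C : ℝ, 0 < C ∧ ∀ (D n k : ℕ) (G : SimpleGraph (Fin n)),
      Nat.card G.edgeSet = k → n ≤ k →
      (∀ s : Finset (Fin n), s.Nonempty → ∃ v ∈ s, {u | u ∈ s ∧ G.Adj v u}.ncard ≤ D) →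
      ∃ m : ℕ, ((m : ℝ) ^ 3 ≤ C * D * k * Real.log n) ∧
        ∃ φ : Fin n → (Fin 3 → ℤ), IsGridDrawing m G φ) ∧
    (∀ Δ : ℕ, ∃ C' : ℝ, 0 < C' ∧ ∀ (n : ℕ) (G : SimpleGraph (Fin n)), 2 ≤ n →
      (∀ v, {u | G.Adj v u}.ncard ≤ Δ) →
      ∃ m : ℕ, ((m : ℝ) ^ 3 ≤ C' * n * Real.log n) ∧
        ∃ φ : Fin n → (Fin 3 → ℤ), IsGridDrawing m G φ) := by
  refine ⟨⟨2 ^ 43, by norm_num, ?_⟩, fun Δ => ⟨2 ^ 43 * (max Δ 1 : ℕ) * (max Δ 1 : ℕ), by positivity, ?_⟩⟩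
  · intro D n k G hk hnk hdeg
    obtain ⟨r, hr, hb⟩ := GD.rank_exists G hdeg
    have hsum := GD.bk_sum G r hr
    rw [hk] at hsum
    classical
    rcases Nat.eq_zero_or_pos n with h0 | h0
    · subst h0
      refine ⟨0, by simp, fun v => v.elim0, ?_, ?_, ?_, ?_⟩
      · intro v; exact v.elim0
      · intro v; exact v.elim0
      · intro v; exact v.elim0
      · intro v; exact v.elim0
    have hle : ∑ v, GD.bk G r v ≤ n * min D n := by
      calc _ ≤ ∑ _v : Fin n, min D n := Finset.sum_le_sum fun v _ => le_min (hb v) (GD.bk_le_n G r v)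
        _ = _ := by simp
    have hD : 1 ≤ min D n := by
      by_contra hcon
      have : min D n = 0 := by omega
      rw [this] at hle
      omega
    have hn2 : 2 ≤ n := by
      by_contra hcon
      have h1 : n = 1 := by omega
      subst h1
      have : ∑ v, GD.bk G r v = 0 := by
        refine Finset.sum_eq_zero fun v _ => ?_
        unfold GD.bk
        rw [Finset.card_eq_zero, Finset.eq_empty_iff_forall_notMem]
        intro u h
        exact (Finset.mem_filter.1 h).2.1.ne (Subsingleton.elim _ _)
      omega
    obtain ⟨m, hm, hφ⟩ := GD.core2 hn2 hD (min_le_right _ _) G r hr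
      (fun v => le_min (hb v) (GD.bk_le_n G r v)) k hnk hsum.le (by
        rw [← hsum]
        refine hle.trans ?_
        rw [pow_two]
        exact Nat.mul_le_mul_left _ (min_le_right _ _))
    refine ⟨m, hm.trans ?_, hφ⟩
    have : ((min D n : ℕ) : ℝ) ≤ D := by exact_mod_cast min_le_left _ _
    have hl : 0 ≤ Real.log n := Real.log_natCast_nonneg n
    gcongr
  · intro n G hn hdeg
    have hr : Function.Injective (fun v : Fin n => (v : ℕ)) := Fin.val_injective
    set r : Fin n → ℕ := fun v => (v : ℕ) with hrdef
    set D := min (max Δ 1) n with hD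
    have hD1 : 1 ≤ D := le_min (le_max_right _ _) (by omega)
    have hDn : D ≤ n := min_le_right _ _
    have hb : ∀ v, GD.bk G r v ≤ D := fun v =>
      le_min (((GD.bk_le_deg G r v).trans (hdeg v)).trans (le_max_left _ _)) (GD.bk_le_n G r v)
    obtain ⟨m, hm, hφ⟩ := GD.core2 hn hD1 hDn G r hr hb (D * n) (Nat.le_mul_of_pos_left _ hD1)
      (by
        calc _ ≤ ∑ _v : Fin n, D := Finset.sum_le_sum fun v _ => hb v
          _ = D * n := by simp [mul_comm])
      (by rw [pow_two]; exact Nat.mul_le_mul_right _ hDn)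
    refine ⟨m, hm.trans ?_, hφ⟩
    have h1 : (D : ℝ) ≤ ((max Δ 1 : ℕ) : ℝ) := by exact_mod_cast min_le_left _ _
    have hl : 0 ≤ Real.log n := Real.log_natCast_nonneg n
    calc (2 : ℝ) ^ 43 * D * ((D * n : ℕ) : ℝ) * Real.log n
        = 2 ^ 43 * D * D * n * Real.log n := by push_cast; ring
      _ ≤ _ := by gcongr
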